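/- Let φ : (0,∞) → (0,∞) be a C¹ function satisfying (φ₁)–(φ₃), N ≥ 1, let a : ℝᴺ → [0,∞) be a continuous radially symmetric function (a(x) = ρ(|x|)) satisfying ∫₁^∞ h⁻¹(𝒜_a(s)) ds = ∞ where 𝒜_a(s) = s^{1−N}·∫₀^s t^{N−1} ρ(t) dt, and let f : [0,∞) → [0,∞) be continuous, non-decreasing, with f(0) = 0 and f(s) > 0 for s > 0. Then the following are equivalent: (1) f does not satisfy the φ-Keller–Osserman condition, i.e. ∫₁^∞ dt/Φ⁻¹(F(t)) = ∞ with F(t) = ∫₀^t f; (2) there exists a sequence of radially symmetric functions u_k ∈ C¹(ℝᴺ), each a positive weak solution of Δ_φ u = a(x)·f(u) in ℝᴺ with u_k(x) → ∞ as |x| → ∞, such that u_k(0) → ∞ as k → ∞. Moreover, in case (2) the radial profiles w_k (u_k(x) = w_k(|x|)) satisfy w_k'(r) ≥ 0 for all r ∈ [0,∞). -/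

import Mathlib

open MeasureTheory Real Set Filter RealInnerProductSpace

/-- The properties of `k = h⁻¹` (extended by zero to negative arguments) and `Ψ = Φ⁻¹` on which the
one-dimensional analysis rests. -/
structure InversePair (k Ψ : ℝ → ℝ) : Prop where
  cont : Continuous k
  mono : Monotone k
  zero : ∀ v ≤ 0, k v = 0
  scale : ∀ C > 0, ∃ κ > 0, ∀ v ≥ 0, κ * k v ≤ k (C * v)
  contΨ : ContinuousOn Ψ (Ici 0)
  monoΨ : MonotoneOn Ψ (Ici 0)
  posΨ : ∀ s > 0, 0 < Ψ s
  upper : ∀ A > 0, ∃ C > 0, ∀ v ≥ 0, ∀ s ≥ 0, ∫ x in (0:ℝ)..v, k x ≤ A * s → k v ≤ C * Ψ s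
  lower : ∀ c > 0, ∃ lam > 0, ∀ v ≥ 0, ∀ s ≥ 0, c * s ≤ ∫ x in (0:ℝ)..v, k x → lam * Ψ s ≤ k v
  superlinear : ∀ c > 0, ∃ M₀ > 0, ∀ M ≥ M₀, ∀ t > 0, ∀ s ≥ 0, ∀ y ≥ 0,
    s ≤ t * y → M * t ≤ Ψ s → M * t ≤ k (c * y)

/-- A monotone surjection of the half-line onto itself, extended by zero, is continuous. -/
lemma continuous_max_of_monotoneOn_surjOn {g : ℝ → ℝ} (hg0 : g 0 = 0)
    (hg : MonotoneOn g (Ici 0)) (hs : ∀ y ≥ 0, ∃ x ≥ 0, g x = y) :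
    Continuous fun v => g (max v 0) := by
  have hnn : ∀ x ≥ 0, 0 ≤ g x := fun x hx => hg0 ▸ hg (mem_Ici.2 le_rfl) hx hx
  have hc : Continuous fun v => if 0 ≤ v then g v else v := by
    apply Monotone.continuous_of_surjective
    · intro a b hab
      dsimp only
      split_ifs with ha hb hb
      · exact hg ha hb hab
      · exact absurd (ha.trans hab) hb
      · exact (not_le.1 ha).le.trans (hnn b hb)
      · exact hab
    · intro y
      rcases le_or_gt 0 y with hy | hy
      · obtain ⟨x, hx, rfl⟩ := hs y hy
        exact ⟨x, if_pos hx⟩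
      · exact ⟨y, if_neg (not_le.2 hy)⟩
  have e : (fun v => g (max v 0)) = fun v => max (if 0 ≤ v then g v else v) 0 := by
    funext v
    split_ifs with hv
    · rw [max_eq_left hv, max_eq_left (hnn v hv)]
    · rw [max_eq_right (not_le.1 hv).le, hg0]
  rw [e]
  exact hc.max continuous_const

lemma strictMonoOn_profile {φ hfun : ℝ → ℝ}
    (hφC1 : ContDiffOn ℝ 1 φ (Ioi 0)) (hφpos : ∀ t > (0:ℝ), 0 < φ t)
    (hφ1 : ∀ t > (0:ℝ), 0 < deriv (fun s => φ s * s) t)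
    (hh0 : hfun 0 = 0) (hhdef : ∀ t > (0:ℝ), hfun t = φ t * t) :
    StrictMonoOn hfun (Ici 0) := by
  have h1 : StrictMonoOn (fun s => φ s * s) (Ioi 0) := by
    apply strictMonoOn_of_deriv_pos (convex_Ioi 0)
    · exact hφC1.continuousOn.mul continuousOn_id
    · intro x hx
      rw [interior_Ioi] at hx
      exact hφ1 x hx
  intro a ha b hb hab
  have hb' : 0 < b := lt_of_le_of_lt ha hab
  rw [hhdef b hb']
  rcases eq_or_lt_of_le (mem_Ici.1 ha) with h | h
  · rw [← h, hh0]
    exact mul_pos (hφpos b hb') hb'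
  · rw [hhdef a h]
    exact h1 h hb' hab

/-- Lower power growth of `h`. -/
lemma profile_mul_le {φ hfun : ℝ → ℝ} {l₁ : ℝ}
    (hφC1 : ContDiffOn ℝ 1 φ (Ioi 0)) (hφpos : ∀ t > (0:ℝ), 0 < φ t)
    (hφ3 : ∀ t > (0:ℝ), l₁ ≤ deriv (fun s => φ s * s) t * t / (φ t * t))
    (hh0 : hfun 0 = 0) (hhdef : ∀ t > (0:ℝ), hfun t = φ t * t)
    {κ t : ℝ} (hκ : 0 < κ) (hκ1 : κ ≤ 1) (ht : 0 ≤ t) :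
    hfun (κ * t) ≤ κ ^ l₁ * hfun t := by
  rcases eq_or_lt_of_le ht with h | ht
  · rw [← h, mul_zero, hh0, mul_zero]
  have hd : ∀ s > (0:ℝ), HasDerivAt (fun s => φ s * s) (deriv (fun s => φ s * s) s) s := by
    intro s hs
    have : DifferentiableAt ℝ φ s :=
      (hφC1.differentiableOn one_ne_zero).differentiableAt (Ioi_mem_nhds hs)
    exact (this.mul differentiableAt_id).hasDerivAt
  have hd2 : ∀ s > (0:ℝ), HasDerivAt (fun s => log (φ s * s) - l₁ * log s)
      (deriv (fun s => φ s * s) s / (φ s * s) - l₁ * s⁻¹) s := by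
    intro s hs
    exact ((hd s hs).log (mul_pos (hφpos s hs) hs).ne').sub
      ((Real.hasDerivAt_log hs.ne').const_mul l₁)
  have hmono : MonotoneOn (fun s => log (φ s * s) - l₁ * log s) (Ioi 0) := by
    apply monotoneOn_of_deriv_nonneg (convex_Ioi 0)
    · exact fun s hs => (hd2 s hs).continuousAt.continuousWithinAt
    · rw [interior_Ioi]
      exact fun s hs => (hd2 s hs).differentiableAt.differentiableWithinAt
    · rw [interior_Ioi]
      intro s hs
      have hs' : (0:ℝ) < s := hs
      rw [(hd2 s hs).deriv]
      have := hφ3 s hs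
      have h2 : l₁ * s⁻¹ ≤ deriv (fun s => φ s * s) s * s / (φ s * s) * s⁻¹ := by gcongr
      have h3 : deriv (fun s => φ s * s) s * s / (φ s * s) * s⁻¹
          = deriv (fun s => φ s * s) s / (φ s * s) := by
        have := (hφpos s hs).ne'
        field_simp
      linarith
  have hκt : 0 < κ * t := mul_pos hκ ht
  have := hmono (mem_Ioi.2 hκt) (mem_Ioi.2 ht) (by nlinarith)
  simp only at this
  rw [log_mul hκ.ne' ht.ne'] at this
  rw [hhdef _ hκt, hhdef _ ht]
  have p1 : 0 < φ (κ * t) * (κ * t) := mul_pos (hφpos _ hκt) hκt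
  have p2 : 0 < φ t * t := mul_pos (hφpos _ ht) ht
  rw [← Real.log_le_log_iff p1 (mul_pos (rpow_pos_of_pos hκ _) p2),
    log_mul (rpow_pos_of_pos hκ _).ne' p2.ne', log_rpow hκ]
  linarith

lemma inversePair_of_hypotheses
    (φ Φ Φinv hfun hinv : ℝ → ℝ)
    (hφC1 : ContDiffOn ℝ 1 φ (Set.Ioi 0))
    (hφpos : ∀ t > (0:ℝ), 0 < φ t)
    (hΦ : ∀ t : ℝ, Φ t = ∫ s in (0:ℝ)..|t|, φ s * s)
    (hφ1 : ∀ t > (0:ℝ), 0 < deriv (fun s => φ s * s) t)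
    (l m l₁ : ℝ) (hl : 1 < l) (hm : 1 < m)
    (hφ2 : ∀ t > (0:ℝ), l ≤ φ t * t ^ 2 / Φ t ∧ φ t * t ^ 2 / Φ t ≤ m)
    (hl₁ : 0 < l₁)
    (hφ3 : ∀ t > (0:ℝ), l₁ ≤ deriv (fun s => φ s * s) t * t / (φ t * t))
    (hΦinv_nonneg : ∀ t ≥ (0:ℝ), 0 ≤ Φinv t)
    (hΦinv_left : ∀ t ≥ (0:ℝ), Φinv (Φ t) = t)
    (hΦinv_right : ∀ t ≥ (0:ℝ), Φ (Φinv t) = t)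
    (hh0 : hfun 0 = 0)
    (hhdef : ∀ t > (0:ℝ), hfun t = φ t * t)
    (hinv_nonneg : ∀ t ≥ (0:ℝ), 0 ≤ hinv t)
    (hinv_left : ∀ t ≥ (0:ℝ), hinv (hfun t) = t)
    (hinv_right : ∀ t ≥ (0:ℝ), hfun (hinv t) = t) :
    InversePair (fun v => hinv (max v 0)) Φinv := by
  have hsm := strictMonoOn_profile hφC1 hφpos hφ1 hh0 hhdef
  have hnn : ∀ t ≥ 0, 0 ≤ hfun t := fun t ht => hh0 ▸ hsm.monotoneOn (mem_Ici.2 le_rfl) ht ht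
  have hcont : Continuous fun v => hfun (max v 0) :=
    continuous_max_of_monotoneOn_surjOn hh0 hsm.monotoneOn
      fun y hy => ⟨hinv y, hinv_nonneg y hy, hinv_right y hy⟩
  have hinv0 : hinv 0 = 0 := by simpa [hh0] using hinv_left 0 le_rfl
  have hle_hinv : ∀ t ≥ 0, ∀ v ≥ 0, hfun t ≤ v → t ≤ hinv v := by
    intro t ht v hv h
    rw [← hsm.le_iff_le ht (hinv_nonneg v hv), hinv_right v hv]
    exact h
  have hinvmono : MonotoneOn hinv (Ici 0) := fun a ha b hb hab =>
    hle_hinv _ (hinv_nonneg a ha) b hb ((hinv_right a ha).trans_le hab)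
  have hkcont : Continuous fun v => hinv (max v 0) :=
    continuous_max_of_monotoneOn_surjOn hinv0 hinvmono
      fun y hy => ⟨hfun y, hnn y hy, hinv_left y hy⟩
  have hkmono : Monotone fun v => hinv (max v 0) := fun a b hab =>
    hinvmono (mem_Ici.2 (le_max_right _ _)) (mem_Ici.2 (le_max_right _ _)) (max_le_max_right 0 hab)
  have hΦeq : ∀ t ≥ 0, Φ t = ∫ s in (0:ℝ)..t, hfun (max s 0) := by
    intro t ht
    rw [hΦ, abs_of_nonneg ht]
    apply intervalIntegral.integral_congr_ae
    refine Filter.Eventually.of_forall fun s hs => ?_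
    rw [uIoc_of_le ht] at hs
    rw [max_eq_left hs.1.le, hhdef s hs.1]
  have hHmono : Monotone fun v => hfun (max v 0) := fun a b hab =>
    hsm.monotoneOn (mem_Ici.2 (le_max_right _ _)) (mem_Ici.2 (le_max_right _ _)) (max_le_max_right 0 hab)
  have hΦle : ∀ t ≥ 0, Φ t ≤ t * hfun t := by
    intro t ht
    rw [hΦeq t ht]
    have : ∫ s in (0:ℝ)..t, hfun (max s 0) ≤ ∫ s in (0:ℝ)..t, hfun t := by
      apply intervalIntegral.integral_mono_on ht (hcont.intervalIntegrable _ _)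
        (by simp)
      intro s hs
      have := hHmono hs.2
      simpa [max_eq_left ht] using this
    simpa using this
  have hΦ0 : Φ 0 = 0 := by simp [hΦ]
  have hleΦ : ∀ t ≥ 0, t * hfun t ≤ m * Φ t := by
    intro t ht
    rcases eq_or_lt_of_le ht with h | ht
    · rw [← h, hΦ0]; simp
    have h1 := hφ2 t ht
    have hpos : 0 < Φ t := by
      have hnn : 0 ≤ Φ t := by
        rw [hΦeq t ht.le]
        exact intervalIntegral.integral_nonneg ht.le fun s _ => hnn _ (le_max_right _ _)
      refine lt_of_le_of_ne hnn fun h => ?_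
      rw [← h] at h1
      simp at h1
      linarith
    have := (div_le_iff₀ hpos).1 h1.2
    rw [hhdef t ht]
    linarith
  have hΦconv : ∀ C ≥ 1, ∀ t ≥ 0, C * Φ t ≤ Φ (C * t) := by
    intro C hC t ht
    have hCt : 0 ≤ C * t := by positivity
    rw [hΦeq t ht, hΦeq _ hCt]
    have h1 := intervalIntegral.mul_integral_comp_mul_left (a := 0) (b := t)
      (f := fun s => hfun (max s 0)) C
    rw [mul_zero] at h1
    rw [← h1]
    gcongr
    apply intervalIntegral.integral_mono_on ht (hcont.intervalIntegrable _ _)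
      ((hcont.comp (continuous_const.mul continuous_id)).intervalIntegrable _ _)
    intro s hs
    exact hHmono (show s ≤ C * s by nlinarith [hs.1])
  have hΦsm : StrictMonoOn Φ (Ici 0) := by
    have hmono : MonotoneOn Φ (Ici 0) := by
      intro a ha b hb hab
      rw [hΦeq a ha, hΦeq b hb, ← intervalIntegral.integral_add_adjacent_intervals
        (hcont.intervalIntegrable 0 a) (hcont.intervalIntegrable a b)]
      have : 0 ≤ ∫ s in a..b, hfun (max s 0) :=
        intervalIntegral.integral_nonneg hab fun s _ => hnn _ (le_max_right _ _)
      linarith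
    refine hmono.strictMonoOn_of_injOn fun a ha b hb hab => ?_
    rw [← hΦinv_left a ha, ← hΦinv_left b hb, hab]
  have hΦnn : ∀ t ≥ 0, 0 ≤ Φ t := fun t ht =>
    hΦ0 ▸ hΦsm.monotoneOn (mem_Ici.2 le_rfl) ht ht
  have hΨmono : MonotoneOn Φinv (Ici 0) := by
    intro a ha b hb hab
    rw [← hΦsm.le_iff_le (hΦinv_nonneg a ha) (hΦinv_nonneg b hb), hΦinv_right a ha,
      hΦinv_right b hb]
    exact hab
  have hΨ0 : Φinv 0 = 0 := by simpa [hΦ0] using hΦinv_left 0 le_rfl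
  have hscale : ∀ C > 0, ∃ κ > 0, ∀ v ≥ 0, κ * hinv (max v 0) ≤ hinv (max (C * v) 0) := by
    intro C hC
    refine ⟨min 1 (C ^ (1 / l₁)), by positivity, fun v hv => ?_⟩
    set κ := min 1 (C ^ (1 / l₁)) with hκdef
    have hκ : 0 < κ := by positivity
    have hCv : 0 ≤ C * v := by positivity
    rw [max_eq_left hv, max_eq_left hCv]
    have hkv := hinv_nonneg v hv
    apply hle_hinv _ (by positivity) _ hCv
    refine (profile_mul_le hφC1 hφpos hφ3 hh0 hhdef hκ (min_le_left _ _) hkv).trans ?_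
    rw [hinv_right v hv]
    gcongr
    calc κ ^ l₁ ≤ (C ^ (1 / l₁)) ^ l₁ := by gcongr; exact min_le_right _ _
      _ = C := by rw [← rpow_mul hC.le, one_div_mul_cancel hl₁.ne', rpow_one]
  refine ⟨hkcont, hkmono, fun v hv => by simp [max_eq_right hv, hinv0], hscale, ?_, hΨmono,
    ?_, ?_, ?_, ?_⟩
  · have := continuous_max_of_monotoneOn_surjOn hΨ0 hΨmono
      fun y hy => ⟨Φ y, hΦnn y hy, hΦinv_left y hy⟩
    refine this.continuousOn.congr fun s hs => ?_
    simp only [max_eq_left (mem_Ici.1 hs)]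
  · intro s hs
    refine lt_of_le_of_ne (hΦinv_nonneg s hs.le) fun h => ?_
    have := hΦinv_right s hs.le
    rw [← h, hΦ0] at this
    exact hs.ne this
  · intro A hA
    obtain ⟨κ, hκ, hκs⟩ := hscale (1 / 2) (by norm_num)
    refine ⟨max 1 (2 * A / κ), by positivity, fun v hv s hs h => ?_⟩
    set C := max 1 (2 * A / κ)
    have hkv := hinv_nonneg v hv
    have h1 : v / 2 * hinv (max (1 / 2 * v) 0) ≤ ∫ x in (0:ℝ)..v, hinv (max x 0) := by
      rw [← intervalIntegral.integral_add_adjacent_intervals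
        (hkcont.intervalIntegrable 0 (v / 2)) (hkcont.intervalIntegrable (v / 2) v)]
      have e1 : 0 ≤ ∫ x in (0:ℝ)..(v / 2), hinv (max x 0) :=
        intervalIntegral.integral_nonneg (by positivity)
          fun x _ => hinv_nonneg _ (le_max_right _ _)
      have e2 : ∫ x in (v / 2)..v, hinv (max (1 / 2 * v) 0) ≤
          ∫ x in (v / 2)..v, hinv (max x 0) := by
        apply intervalIntegral.integral_mono_on (by linarith) (by simp)
          (hkcont.intervalIntegrable _ _)
        intro x hx
        exact hkmono (by linarith [hx.1])
      rw [intervalIntegral.integral_const, smul_eq_mul] at e2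
      have : v - v / 2 = v / 2 := by ring
      rw [this] at e2
      linarith
    have h2 := hκs v hv
    rw [max_eq_left hv] at h2
    have h3 : v / 2 * (κ * hinv v) ≤ A * s :=
      (mul_le_mul_of_nonneg_left h2 (by positivity)).trans (h1.trans h)
    have h4 := hΦle _ hkv
    rw [hinv_right v hv] at h4
    have h5 : Φ (hinv v) ≤ C * s := by
      calc Φ (hinv v) ≤ 2 * A / κ * s := by
            rw [div_mul_eq_mul_div, le_div_iff₀ hκ]; nlinarith
        _ ≤ C * s := by gcongr; exact le_max_right _ _
    have hΨs := hΦinv_nonneg s hs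
    have h6 := hΦconv C (le_max_left _ _) _ hΨs
    rw [hΦinv_right s hs] at h6
    simp only [max_eq_left hv]
    rw [← hΦsm.le_iff_le hkv (mem_Ici.2 (by positivity : 0 ≤ C * Φinv s))]
    exact h5.trans h6
  · intro c hc
    refine ⟨(max 1 (m / c))⁻¹, by positivity, fun v hv s hs h => ?_⟩
    set C := max 1 (m / c)
    have hC : 0 < C := by positivity
    have hkv := hinv_nonneg v hv
    simp only [max_eq_left hv]
    rw [inv_mul_le_iff₀ hC, ← hΦsm.le_iff_le (hΦinv_nonneg s hs)
      (mem_Ici.2 (by positivity : 0 ≤ C * hinv v)), hΦinv_right s hs]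
    refine le_trans ?_ (hΦconv C (le_max_left _ _) _ hkv)
    have h1 : ∫ x in (0:ℝ)..v, hinv (max x 0) ≤ v * hinv v := by
      have : ∫ x in (0:ℝ)..v, hinv (max x 0) ≤ ∫ x in (0:ℝ)..v, hinv v := by
        apply intervalIntegral.integral_mono_on hv (hkcont.intervalIntegrable _ _) (by simp)
        intro s hs
        have := hkmono hs.2
        simpa [max_eq_left hv] using this
      simpa using this
    have h2 := hleΦ _ hkv
    rw [hinv_right v hv] at h2
    calc s ≤ m / c * Φ (hinv v) := by
          rw [div_mul_eq_mul_div, le_div_iff₀ hc]; linarith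
      _ ≤ C * Φ (hinv v) := by
          have := hΦnn _ hkv
          gcongr; exact le_max_right _ _
  · intro c hc
    refine ⟨m / c, by positivity, fun M hM t ht s hs y hy h1 h2 => ?_⟩
    have hM0 : 0 < M := lt_of_lt_of_le (by positivity) hM
    have hMt : 0 ≤ M * t := by positivity
    have hcy : 0 ≤ c * y := by positivity
    simp only [max_eq_left hcy]
    apply hle_hinv _ hMt _ hcy
    have h3 : Φ (M * t) ≤ s := by
      have := hΦsm.monotoneOn (mem_Ici.2 hMt) (hΦinv_nonneg s hs) h2
      rwa [hΦinv_right s hs] at this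
    have h4 := hleΦ _ hMt
    have h5 : M * hfun (M * t) ≤ m * y := by
      have : t * (M * hfun (M * t)) ≤ t * (m * y) := by nlinarith
      exact le_of_mul_le_mul_left this ht
    have h6 : m ≤ M * c := (div_le_iff₀ hc).1 hM
    have h7 : M * hfun (M * t) ≤ M * (c * y) := by nlinarith
    exact le_of_mul_le_mul_left h7 hM0

lemma le_of_hasDerivAt_nonneg {D D' : ℝ → ℝ} {a b : ℝ} (hab : a ≤ b)
    (hc : ContinuousOn D (Icc a b)) (hd : ∀ x ∈ Ioo a b, HasDerivAt D (D' x) x)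
    (hn : ∀ x ∈ Ioo a b, 0 ≤ D' x) : D a ≤ D b := by
  have : MonotoneOn D (Icc a b) := by
    apply monotoneOn_of_deriv_nonneg (convex_Icc a b) hc
    · rw [interior_Icc]
      exact fun x hx => (hd x hx).differentiableAt.differentiableWithinAt
    · rw [interior_Icc]
      intro x hx
      rw [(hd x hx).deriv]
      exact hn x hx
  exact this (left_mem_Icc.2 hab) (right_mem_Icc.2 hab) hab

lemma hasDerivAt_primitive {g : ℝ → ℝ} (hg : Continuous g) (a x : ℝ) :
    HasDerivAt (fun r => ∫ s in a..r, g s) (g x) x :=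
  intervalIntegral.integral_hasDerivAt_right (hg.intervalIntegrable _ _)
    (hg.stronglyMeasurableAtFilter _ _) hg.continuousAt

/-- A nonnegative function with divergent integral has a primitive tending to infinity. -/
lemma exists_lt_integral_of_not_integrableOn {G : ℝ → ℝ} (hc : ContinuousOn G (Ici 1))
    (hn : ∀ t ≥ 1, 0 ≤ G t) (hG : ¬ IntegrableOn G (Ioi 1)) (B : ℝ) :
    ∃ T ≥ 1, ∀ r ≥ T, B < ∫ t in (1:ℝ)..r, G t := by
  have hii : ∀ a b, 1 ≤ a → a ≤ b → IntervalIntegrable G volume a b := fun a b ha hab =>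
    (hc.mono fun x hx => by
      rw [uIcc_of_le hab] at hx
      exact ha.trans hx.1).intervalIntegrable
  by_contra! hcon
  apply hG
  have hb : ∀ r ≥ 1, ∫ t in (1:ℝ)..r, G t ≤ B := by
    intro r hr
    obtain ⟨s, hs, h⟩ := hcon r hr
    rw [← intervalIntegral.integral_add_adjacent_intervals (hii 1 r le_rfl hr)
      (hii r s hr hs)] at h
    have : 0 ≤ ∫ t in r..s, G t :=
      intervalIntegral.integral_nonneg hs fun u hu => hn u (le_trans hr hu.1)
    linarith
  apply integrableOn_Ioi_of_intervalIntegral_norm_bounded B 1 (l := atTop) (b := id) ?_ tendsto_id ?_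
  · intro r
    rcases le_total 1 r with hr | hr
    · exact (intervalIntegrable_iff_integrableOn_Ioc_of_le hr).1 (hii 1 r le_rfl hr)
    · simp [Ioc_eq_empty_of_le hr]
  · filter_upwards [eventually_ge_atTop 1] with r hr
    refine le_trans (le_of_eq ?_) (hb r hr)
    apply intervalIntegral.integral_congr
    intro x hx
    rw [id, uIcc_of_le hr] at hx
    exact Real.norm_of_nonneg (hn x hx.1)

lemma exists_integral_lt_of_integrableOn {G : ℝ → ℝ}
    (hG : IntegrableOn G (Ioi 1)) {ε : ℝ} (hε : 0 < ε) :
    ∃ T ≥ 1, ∀ a b, T ≤ a → a ≤ b → ∫ t in a..b, G t < ε := by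
  have ht := intervalIntegral_tendsto_integral_Ioi 1 hG tendsto_id
  have hev := (Metric.tendsto_nhds.1 ht) (ε / 2) (by positivity)
  obtain ⟨T, hT⟩ := eventually_atTop.1 hev
  have hii : ∀ b ≥ 1, IntervalIntegrable G volume 1 b := fun b hb =>
    (intervalIntegrable_iff_integrableOn_Ioc_of_le hb).2 (hG.mono_set Ioc_subset_Ioi_self)
  refine ⟨max T 1, le_max_right _ _, fun a b ha hab => ?_⟩
  have h1 := hT a ((le_max_left _ _).trans ha)
  have h2 := hT b (((le_max_left _ _).trans ha).trans hab)
  have ha1 : 1 ≤ a := (le_max_right _ _).trans ha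
  rw [Real.dist_eq, abs_lt] at h1 h2
  rw [← intervalIntegral.integral_interval_sub_left (hii b (ha1.trans hab)) (hii a ha1)]
  simp only [id] at h1 h2
  linarith [h1.1, h2.2]

/-- `s^{-n} ∫₀ˢ tⁿ g(t) dt`, in a form that is continuous across `s = 0`. -/
noncomputable def flux (n : ℕ) (g : ℝ → ℝ) (s : ℝ) : ℝ :=
  s * ∫ τ in (0:ℝ)..1, τ ^ n * g (s * τ)

lemma continuous_flux (n : ℕ) {g : ℝ → ℝ} (hg : Continuous g) : Continuous (flux n g) := by
  unfold flux
  refine continuous_id.mul ?_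
  apply intervalIntegral.continuous_parametric_intervalIntegral_of_continuous'
  simp only [Function.uncurry_def]
  fun_prop

lemma pow_mul_flux (n : ℕ) (g : ℝ → ℝ) (s : ℝ) :
    s ^ n * flux n g s = ∫ t in (0:ℝ)..s, t ^ n * g t := by
  have h := intervalIntegral.mul_integral_comp_mul_left (a := 0) (b := 1)
    (f := fun t => t ^ n * g t) s
  rw [mul_zero, mul_one] at h
  rw [← h, flux, mul_left_comm, ← intervalIntegral.integral_const_mul]
  congr 1
  apply intervalIntegral.integral_congr
  intro τ _
  simp only
  ring

lemma flux_zero (n : ℕ) (g : ℝ → ℝ) : flux n g 0 = 0 := by simp [flux]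

lemma flux_mono (n : ℕ) {g₁ g₂ : ℝ → ℝ} (h₁ : Continuous g₁) (h₂ : Continuous g₂) {s : ℝ}
    (hs : 0 ≤ s) (h : ∀ t ∈ Icc 0 s, g₁ t ≤ g₂ t) : flux n g₁ s ≤ flux n g₂ s := by
  unfold flux
  gcongr
  apply intervalIntegral.integral_mono_on zero_le_one
    ((by fun_prop : Continuous fun τ => τ ^ n * g₁ (s * τ)).intervalIntegrable _ _)
    ((by fun_prop : Continuous fun τ => τ ^ n * g₂ (s * τ)).intervalIntegrable _ _)
  intro τ hτ
  have h0 := hτ.1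
  have := h (s * τ) ⟨by positivity, by nlinarith [hτ.2]⟩
  gcongr

lemma flux_nonneg (n : ℕ) {g : ℝ → ℝ} (hg : ∀ t, 0 ≤ g t) {s : ℝ} (hs : 0 ≤ s) :
    0 ≤ flux n g s :=
  mul_nonneg hs (intervalIntegral.integral_nonneg zero_le_one fun _ hτ =>
    mul_nonneg (pow_nonneg hτ.1 _) (hg _))

lemma flux_nonpos (n : ℕ) {g : ℝ → ℝ} (hg : ∀ t, 0 ≤ g t) {s : ℝ} (hs : s ≤ 0) :
    flux n g s ≤ 0 :=
  mul_nonpos_of_nonpos_of_nonneg hs (intervalIntegral.integral_nonneg zero_le_one fun _ hτ =>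
    mul_nonneg (pow_nonneg hτ.1 _) (hg _))

lemma flux_const_mul (n : ℕ) (c : ℝ) (g : ℝ → ℝ) (s : ℝ) :
    flux n (fun t => c * g t) s = c * flux n g s := by
  unfold flux
  rw [mul_left_comm c s, ← intervalIntegral.integral_const_mul c]
  congr 1
  apply intervalIntegral.integral_congr
  intro τ _
  simp only
  ring

lemma flux_const_le (n : ℕ) {c : ℝ} (hc : 0 ≤ c) {s : ℝ} (hs : 0 ≤ s) :
    flux n (fun _ => c) s ≤ s * c := by
  unfold flux
  gcongr
  have : ∫ τ in (0:ℝ)..1, τ ^ n * c ≤ ∫ τ in (0:ℝ)..1, c := by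
    apply intervalIntegral.integral_mono_on zero_le_one
      ((by fun_prop : Continuous fun τ : ℝ => τ ^ n * c).intervalIntegrable _ _) (by simp)
    intro τ hτ
    exact mul_le_of_le_one_left hc (pow_le_one₀ hτ.1 hτ.2)
  simpa using this

lemma hasDerivAt_flux (n : ℕ) {g : ℝ → ℝ} (hg : Continuous g) {s : ℝ} (hs : 0 < s) :
    HasDerivAt (flux n g) (g s - n / s * flux n g s) s := by
  have h1 : HasDerivAt (fun s => ∫ t in (0:ℝ)..s, t ^ n * g t) (s ^ n * g s) s :=
    hasDerivAt_primitive (by fun_prop : Continuous fun t => t ^ n * g t) 0 s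
  have h2 := ((hasDerivAt_pow n s).inv (pow_pos hs n).ne').mul h1
  have h3 : HasDerivAt (flux n g) _ s := h2.congr_of_eventuallyEq (by
    filter_upwards [Ioi_mem_nhds hs] with x hx
    have hx0 : x ^ n ≠ 0 := (pow_pos (mem_Ioi.1 hx) n).ne'
    simp only [Pi.mul_apply, Pi.inv_apply]
    rw [← pow_mul_flux, inv_mul_cancel_left₀ hx0])
  convert h3 using 1
  simp only [Pi.inv_apply]
  rw [← pow_mul_flux]
  have hsn : s ^ n ≠ 0 := (pow_pos hs n).ne'
  rcases n with _ | n
  · simp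
  · simp only [Nat.add_sub_cancel]
    field_simp
    ring

section Analysis

variable {k Ψ f ρ : ℝ → ℝ}

lemma InversePair.nonneg (H : InversePair k Ψ) (v : ℝ) : 0 ≤ k v := by
  rcases le_total v 0 with h | h
  · rw [H.zero v h]
  · rw [← H.zero 0 le_rfl]
    exact H.mono h

/-- Standing assumptions on the nonlinearity. -/
structure Nonlinearity (f : ℝ → ℝ) : Prop where
  cont : Continuous f
  mono : Monotone f
  pos : ∀ s > 0, 0 < f s
  nonneg : ∀ s, 0 ≤ f s

lemma Nonlinearity.primitive_pos (hf : Nonlinearity f) {t : ℝ} (ht : 0 < t) :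
    0 < ∫ s in (0:ℝ)..t, f s :=
  intervalIntegral.intervalIntegral_pos_of_pos_on (hf.cont.intervalIntegrable _ _)
    (fun x hx => hf.pos x hx.1) ht

lemma Nonlinearity.primitive_mono (hf : Nonlinearity f) :
    Monotone fun t => ∫ s in (0:ℝ)..t, f s := by
  intro a b hab
  simp only
  rw [← intervalIntegral.integral_add_adjacent_intervals
    (hf.cont.intervalIntegrable 0 a) (hf.cont.intervalIntegrable a b)]
  have : 0 ≤ ∫ s in a..b, f s := intervalIntegral.integral_nonneg hab fun s _ => hf.nonneg s
  linarith

lemma Nonlinearity.primitive_le (hf : Nonlinearity f) {t : ℝ} (ht : 0 ≤ t) :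
    ∫ s in (0:ℝ)..t, f s ≤ t * f t := by
  have : ∫ s in (0:ℝ)..t, f s ≤ ∫ s in (0:ℝ)..t, f t := by
    apply intervalIntegral.integral_mono_on ht (hf.cont.intervalIntegrable _ _) (by simp)
    exact fun s hs => hf.mono hs.2
  simpa using this

lemma Nonlinearity.two_mul_primitive_le (hf : Nonlinearity f) {x y : ℝ} (hx : 0 ≤ x)
    (hxy : 2 * x ≤ y) : 2 * ∫ s in (0:ℝ)..x, f s ≤ ∫ s in (0:ℝ)..y, f s := by
  refine le_trans ?_ (hf.primitive_mono hxy)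
  simp only
  rw [← intervalIntegral.integral_add_adjacent_intervals
    (hf.cont.intervalIntegrable 0 x) (hf.cont.intervalIntegrable x (2 * x))]
  have h1 := hf.primitive_le hx
  have h2 : ∫ s in x..(2 * x), f x ≤ ∫ s in x..(2 * x), f s := by
    apply intervalIntegral.integral_mono_on (by linarith) (by simp)
      (hf.cont.intervalIntegrable _ _)
    exact fun s hs => hf.mono hs.1
  rw [intervalIntegral.integral_const, smul_eq_mul] at h2
  have : 2 * x - x = x := by ring
  rw [this] at h2
  linarith

/-- The Keller–Osserman integrand. -/
noncomputable def koIntegrand (Ψ f : ℝ → ℝ) (t : ℝ) : ℝ := 1 / Ψ (∫ s in (0:ℝ)..t, f s)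

lemma koIntegrand_continuousOn (H : InversePair k Ψ) (hf : Nonlinearity f) :
    ContinuousOn (koIntegrand Ψ f) (Ioi 0) := by
  have h1 : ContinuousOn (fun t => Ψ (∫ s in (0:ℝ)..t, f s)) (Ioi 0) := by
    apply H.contΨ.comp
    · exact fun t _ => (hasDerivAt_primitive hf.cont 0 t).continuousAt.continuousWithinAt
    · exact fun t ht => (hf.primitive_pos ht).le
  exact continuousOn_const.div h1 fun t ht => (H.posΨ _ (hf.primitive_pos ht)).ne'

lemma koIntegrand_pos (H : InversePair k Ψ) (hf : Nonlinearity f) {t : ℝ} (ht : 0 < t) :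
    0 < koIntegrand Ψ f t := one_div_pos.2 (H.posΨ _ (hf.primitive_pos ht))

lemma hasDerivAt_integral_koIntegrand (H : InversePair k Ψ) (hf : Nonlinearity f) {a t : ℝ}
    (ha : 0 < a) (ht : 0 < t) :
    HasDerivAt (fun t => ∫ s in a..t, koIntegrand Ψ f s) (koIntegrand Ψ f t) t := by
  have hc := koIntegrand_continuousOn H hf
  apply intervalIntegral.integral_hasDerivAt_right
  · refine (hc.mono fun x hx => ?_).intervalIntegrable
    exact lt_of_lt_of_le (lt_min ha ht) hx.1
  · exact hc.stronglyMeasurableAtFilter isOpen_Ioi t ht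
  · exact hc.continuousAt (Ioi_mem_nhds ht)

/-- A priori bound for subsolutions of the radial integral equation. -/
lemma exists_apriori_bound (H : InversePair k Ψ) (hf : Nonlinearity f) (n : ℕ)
    (hρ : Continuous ρ) (hρ0 : ∀ t, 0 ≤ ρ t) {R A : ℝ} (hA : 0 < A)
    (hρA : ∀ t ∈ Icc 0 R, ρ t ≤ A) :
    ∃ C > 0, ∀ α ≥ 1, ∀ z w : ℝ → ℝ, Continuous z →
      (∀ r, w r = α + ∫ s in (0:ℝ)..r, k (flux n (fun t => ρ t * f (z t)) s)) →
      (∀ r ∈ Icc 0 R, z r ≤ w r) → ∀ r ∈ Icc 0 R,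
      ∫ t in (1:ℝ)..(w r), koIntegrand Ψ f t ≤
        (∫ t in (1:ℝ)..α, koIntegrand Ψ f t) + C * r := by
  obtain ⟨C, hC, hup⟩ := H.upper A hA
  refine ⟨C, hC, fun α hα z w hz hw hzw r hr => ?_⟩
  set g : ℝ → ℝ := fun t => ρ t * f (z t) with hgdef
  have hg : Continuous g := hρ.mul (hf.cont.comp hz)
  have hg0 : ∀ t, 0 ≤ g t := fun t => mul_nonneg (hρ0 t) (hf.nonneg _)
  have hkc : Continuous fun s => k (flux n g s) := H.cont.comp (continuous_flux n hg)
  have hwd : ∀ s, HasDerivAt w (k (flux n g s)) s := by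
    intro s
    have h := (hasDerivAt_primitive hkc 0 s).const_add α
    have e : w = fun r => α + ∫ s in (0:ℝ)..r, k (flux n g s) := funext hw
    rw [e]
    exact h
  have hwc : Continuous w := continuous_iff_continuousAt.2 fun s => (hwd s).continuousAt
  have hw0 : w 0 = α := by simp [hw]
  have hwα : ∀ s ≥ 0, α ≤ w s := by
    intro s hs
    rw [hw]
    have := intervalIntegral.integral_nonneg hs (μ := volume)
      fun u _ => H.nonneg (flux n g u)
    linarith
  have hKd : ∀ v, HasDerivAt (fun v => ∫ x in (0:ℝ)..v, k x) (k v) v :=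
    hasDerivAt_primitive H.cont 0
  have hFd : ∀ v, HasDerivAt (fun v => ∫ x in (0:ℝ)..v, f x) (f v) v :=
    hasDerivAt_primitive hf.cont 0
  have hKc : Continuous (fun v => ∫ x in (0:ℝ)..v, k x) :=
    continuous_iff_continuousAt.2 fun s => (hKd s).continuousAt
  have hFc : Continuous (fun v => ∫ x in (0:ℝ)..v, f x) :=
    continuous_iff_continuousAt.2 fun s => (hFd s).continuousAt
  have henergy : ∀ s ∈ Icc 0 R,
      ∫ x in (0:ℝ)..(flux n g s), k x ≤ A * ∫ x in (0:ℝ)..(w s), f x := by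
    intro s hs
    have hle := le_of_hasDerivAt_nonneg hs.1
      (D := fun s => A * (∫ x in (0:ℝ)..(w s), f x) - ∫ x in (0:ℝ)..(flux n g s), k x)
      (D' := fun s => A * (f (w s) * k (flux n g s)) -
        k (flux n g s) * (g s - n / s * flux n g s))
      (((hFc.comp hwc).const_mul A |>.sub (hKc.comp (continuous_flux n hg))).continuousOn)
      (fun x hx => ((((hFd (w x)).comp x (hwd x)).const_mul A).sub
        ((hKd _).comp x (hasDerivAt_flux n hg hx.1))))
      (fun x hx => by
        have hx' : x ∈ Icc 0 R := ⟨hx.1.le, hx.2.le.trans hs.2⟩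
        have h1 : g x ≤ A * f (w x) :=
          mul_le_mul (hρA x hx') (hf.mono (hzw x hx')) (hf.nonneg _) hA.le
        have h2 : 0 ≤ n / x * flux n g x :=
          mul_nonneg (div_nonneg (Nat.cast_nonneg n) hx.1.le) (flux_nonneg n hg0 hx.1.le)
        have h3 := H.nonneg (flux n g x)
        nlinarith)
    simp only [flux_zero, intervalIntegral.integral_same, hw0] at hle
    have : 0 ≤ ∫ x in (0:ℝ)..α, f x := (hf.primitive_pos (by linarith)).le
    have := mul_nonneg hA.le this
    linarith
  have hpos : ∀ s ≥ 0, 0 < w s := fun s hs => lt_of_lt_of_le (by linarith) (hwα s hs)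
  have hle := le_of_hasDerivAt_nonneg hr.1
      (D := fun s => C * s - ∫ t in (1:ℝ)..(w s), koIntegrand Ψ f t)
      (D' := fun s => C * 1 - koIntegrand Ψ f (w s) * k (flux n g s))
      (fun x hx => (((hasDerivAt_id x).const_mul C).sub
        ((hasDerivAt_integral_koIntegrand H hf one_pos (hpos x hx.1)).comp x
          (hwd x))).continuousAt.continuousWithinAt)
      (fun x hx => ((hasDerivAt_id x).const_mul C).sub
        ((hasDerivAt_integral_koIntegrand H hf one_pos (hpos x hx.1.le)).comp x (hwd x)))
      (fun x hx => by
        have hF := hf.primitive_pos (hpos x hx.1.le)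
        have h1 := hup _ (flux_nonneg n hg0 hx.1.le) _ hF.le
          (henergy x ⟨hx.1.le, hx.2.le.trans hr.2⟩)
        have h2 := H.posΨ _ hF
        rw [koIntegrand, one_div_mul_eq_div, sub_nonneg, div_le_iff₀ h2]
        linarith)
  simp only [hw0] at hle
  linarith

end Analysis

section Existence

variable {k Ψ f ρ : ℝ → ℝ}

/-- The monotone integral operator whose fixed points are the radial profiles. -/
noncomputable def radialStep (k f ρ : ℝ → ℝ) (n : ℕ) (α : ℝ) (z : ℝ → ℝ) (r : ℝ) : ℝ :=
  α + ∫ s in (0:ℝ)..r, k (flux n (fun t => ρ t * f (z t)) s)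

noncomputable def radialIter (k f ρ : ℝ → ℝ) (n : ℕ) (α : ℝ) : ℕ → ℝ → ℝ
  | 0 => fun _ => α
  | j + 1 => radialStep k f ρ n α (radialIter k f ρ n α j)

lemma continuous_kernel (H : InversePair k Ψ) (hf : Nonlinearity f) (n : ℕ)
    (hρ : Continuous ρ) {z : ℝ → ℝ} (hz : Continuous z) :
    Continuous fun s => k (flux n (fun t => ρ t * f (z t)) s) :=
  H.cont.comp (continuous_flux n (hρ.mul (hf.cont.comp hz)))

lemma hasDerivAt_radialStep (H : InversePair k Ψ) (hf : Nonlinearity f) (n : ℕ)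
    (hρ : Continuous ρ) (α : ℝ) {z : ℝ → ℝ} (hz : Continuous z) (r : ℝ) :
    HasDerivAt (radialStep k f ρ n α z) (k (flux n (fun t => ρ t * f (z t)) r)) r :=
  (hasDerivAt_primitive (continuous_kernel H hf n hρ hz) 0 r).const_add α

lemma continuous_radialStep (H : InversePair k Ψ) (hf : Nonlinearity f) (n : ℕ)
    (hρ : Continuous ρ) (α : ℝ) {z : ℝ → ℝ} (hz : Continuous z) :
    Continuous (radialStep k f ρ n α z) :=
  continuous_iff_continuousAt.2 fun r => (hasDerivAt_radialStep H hf n hρ α hz r).continuousAt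

lemma radialStep_of_nonpos (H : InversePair k Ψ) (hf : Nonlinearity f) (n : ℕ)
    (hρ0 : ∀ t, 0 ≤ ρ t) (α : ℝ) (z : ℝ → ℝ) {r : ℝ} (hr : r ≤ 0) :
    radialStep k f ρ n α z r = α := by
  have : ∫ s in (0:ℝ)..r, k (flux n (fun t => ρ t * f (z t)) s) = ∫ s in (0:ℝ)..r, (0:ℝ) := by
    apply intervalIntegral.integral_congr
    intro s hs
    rw [uIcc_of_ge hr] at hs
    exact H.zero _ (flux_nonpos n (fun t => mul_nonneg (hρ0 t) (hf.nonneg _)) hs.2)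
  simp [radialStep, this]

lemma le_radialStep (H : InversePair k Ψ) (hf : Nonlinearity f) (n : ℕ)
    (hρ0 : ∀ t, 0 ≤ ρ t) (α : ℝ) (z : ℝ → ℝ) (r : ℝ) : α ≤ radialStep k f ρ n α z r := by
  rcases le_total r 0 with hr | hr
  · exact (radialStep_of_nonpos H hf n hρ0 α z hr).ge
  · have := intervalIntegral.integral_nonneg hr (μ := volume)
      fun u _ => H.nonneg (flux n (fun t => ρ t * f (z t)) u)
    simp only [radialStep]
    linarith

lemma radialStep_mono (H : InversePair k Ψ) (hf : Nonlinearity f) (n : ℕ)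
    (hρ : Continuous ρ) (hρ0 : ∀ t, 0 ≤ ρ t) (α : ℝ) {y z : ℝ → ℝ} (hy : Continuous y)
    (hz : Continuous z) (hyz : ∀ t, y t ≤ z t) (r : ℝ) :
    radialStep k f ρ n α y r ≤ radialStep k f ρ n α z r := by
  rcases le_total r 0 with hr | hr
  · rw [radialStep_of_nonpos H hf n hρ0 α y hr, radialStep_of_nonpos H hf n hρ0 α z hr]
  · simp only [radialStep]
    gcongr
    apply intervalIntegral.integral_mono_on hr
      ((continuous_kernel H hf n hρ hy).intervalIntegrable _ _)
      ((continuous_kernel H hf n hρ hz).intervalIntegrable _ _)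
    intro s hs
    apply H.mono
    exact flux_mono n (hρ.mul (hf.cont.comp hy)) (hρ.mul (hf.cont.comp hz)) hs.1
      fun t _ => mul_le_mul_of_nonneg_left (hf.mono (hyz t)) (hρ0 t)

lemma continuous_radialIter (H : InversePair k Ψ) (hf : Nonlinearity f) (n : ℕ)
    (hρ : Continuous ρ) (α : ℝ) (j : ℕ) : Continuous (radialIter k f ρ n α j) := by
  induction j with
  | zero => exact continuous_const
  | succ j ih => exact continuous_radialStep H hf n hρ α ih

lemma radialIter_le_succ (H : InversePair k Ψ) (hf : Nonlinearity f) (n : ℕ)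
    (hρ : Continuous ρ) (hρ0 : ∀ t, 0 ≤ ρ t) (α : ℝ) (j : ℕ) (r : ℝ) :
    radialIter k f ρ n α j r ≤ radialIter k f ρ n α (j + 1) r := by
  induction j generalizing r with
  | zero => exact le_radialStep H hf n hρ0 α _ r
  | succ j ih =>
    exact radialStep_mono H hf n hρ hρ0 α (continuous_radialIter H hf n hρ α j)
      (continuous_radialIter H hf n hρ α (j + 1)) ih r

lemma exists_bound_radialIter (H : InversePair k Ψ) (hf : Nonlinearity f) (n : ℕ)
    (hρ : Continuous ρ) (hρ0 : ∀ t, 0 ≤ ρ t)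
    (hKO : ¬ IntegrableOn (koIntegrand Ψ f) (Ioi 1)) {α : ℝ} (hα : 1 ≤ α) (R : ℝ) :
    ∃ T ≥ 1, ∀ j, ∀ r ≤ R, radialIter k f ρ n α j r ≤ T := by
  obtain ⟨A₀, hA₀⟩ := (isCompact_Icc (a := (0:ℝ)) (b := R)).bddAbove_image hρ.continuousOn
  have hρA : ∀ t ∈ Icc 0 R, ρ t ≤ max A₀ 1 := fun t ht =>
    (hA₀ (mem_image_of_mem _ ht)).trans (le_max_left _ _)
  obtain ⟨C, hC, hap⟩ := exists_apriori_bound H hf n hρ hρ0 (by positivity) hρA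
  obtain ⟨T, hT1, hT⟩ := exists_lt_integral_of_not_integrableOn
    ((koIntegrand_continuousOn H hf).mono fun t (ht : (1:ℝ) ≤ t) => lt_of_lt_of_le one_pos ht)
    (fun t ht => (koIntegrand_pos H hf (lt_of_lt_of_le one_pos ht)).le) hKO
    ((∫ t in (1:ℝ)..α, koIntegrand Ψ f t) + C * R)
  refine ⟨max T α, le_max_of_le_left hT1, fun j r hr => ?_⟩
  rcases j with _ | j
  · exact le_max_right _ _
  rcases le_total r 0 with hr0 | hr0
  · refine le_trans (le_of_eq ?_) (le_max_right _ _)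
    exact radialStep_of_nonpos H hf n hρ0 α _ hr0
  · by_contra! hcon
    have h1 := hap α hα (radialIter k f ρ n α j) (radialIter k f ρ n α (j + 1))
      (continuous_radialIter H hf n hρ α j) (fun r => rfl)
      (fun r _ => radialIter_le_succ H hf n hρ hρ0 α j r) r ⟨hr0, hr⟩
    have h2 := hT _ ((le_max_left _ _).trans hcon.le)
    have h3 : C * r ≤ C * R := by gcongr
    linarith

/-- Global existence for the radial integral equation when the Keller–Osserman condition fails. -/
lemma exists_radial_profile (H : InversePair k Ψ) (hf : Nonlinearity f) (n : ℕ)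
    (hρ : Continuous ρ) (hρ0 : ∀ t, 0 ≤ ρ t)
    (hKO : ¬ IntegrableOn (koIntegrand Ψ f) (Ioi 1)) {α : ℝ} (hα : 1 ≤ α) :
    ∃ w : ℝ → ℝ, Continuous w ∧ ∀ r, w r = radialStep k f ρ n α w r := by
  set W := radialIter k f ρ n α with hW
  have hWc : ∀ j, Continuous (W j) := continuous_radialIter H hf n hρ α
  have hWm : ∀ r, Monotone fun j => W j r := fun r =>
    monotone_nat_of_le_succ fun j => radialIter_le_succ H hf n hρ hρ0 α j r
  choose T hT1 hT using exists_bound_radialIter H hf n hρ hρ0 hKO hα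
  set w : ℝ → ℝ := fun r => ⨆ j, W j r with hwdef
  have hlim : ∀ r, Tendsto (fun j => W j r) atTop (nhds (w r)) := fun r =>
    tendsto_atTop_ciSup (hWm r) ⟨T r, by rintro _ ⟨j, rfl⟩; exact hT r j r le_rfl⟩
  -- uniform bounds on the flux over compact intervals
  have hbound : ∀ R ≥ 0, ∃ L : ℝ, ∀ j, ∀ s ≤ R, k (flux n (fun t => ρ t * f (W j t)) s) ≤ L := by
    intro R hR
    obtain ⟨A, hA⟩ := (isCompact_Icc (a := (0:ℝ)) (b := R)).bddAbove_image hρ.continuousOn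
    have hA0 : 0 ≤ A := (hρ0 0).trans (hA (mem_image_of_mem _ ⟨le_rfl, hR⟩))
    have hc0 : 0 ≤ A * f (T R) := mul_nonneg hA0 (hf.nonneg _)
    refine ⟨k (R * (A * f (T R))), fun j s hs => H.mono ?_⟩
    rcases le_total s 0 with hs0 | hs0
    · exact (flux_nonpos n (fun t => mul_nonneg (hρ0 t) (hf.nonneg _)) hs0).trans (by positivity)
    · refine (flux_mono n (hρ.mul (hf.cont.comp (hWc j)))
        (continuous_const (y := A * f (T R))) hs0 fun t ht => ?_).trans
        ((flux_const_le n hc0 hs0).trans (by gcongr))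
      have htR : t ≤ R := ht.2.trans hs
      exact mul_le_mul (hA (mem_image_of_mem _ ⟨ht.1, htR⟩)) (hf.mono (hT R j t htR))
        (hf.nonneg _) hA0
  have hwc : Continuous w := by
    rw [continuous_iff_continuousAt]
    intro r₀
    set R := |r₀| + 1
    obtain ⟨L, hL⟩ := hbound R (by positivity)
    have hlip : LipschitzOnWith L.toNNReal w (Iic R) := by
      apply LipschitzOnWith.of_dist_le_mul
      intro x hx y hy
      refine le_of_tendsto (((hlim x).comp (tendsto_add_atTop_nat 1)).dist
        ((hlim y).comp (tendsto_add_atTop_nat 1))) (Eventually.of_forall fun j => ?_)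
      have hii := fun a b => (continuous_kernel H hf n hρ (hWc j)).intervalIntegrable
        (μ := volume) a b
      have e : W (j + 1) x - W (j + 1) y
          = ∫ s in y..x, k (flux n (fun t => ρ t * f (W j t)) s) := by
        rw [← intervalIntegral.integral_interval_sub_left (hii 0 x) (hii 0 y)]
        simp only [hW, radialIter, radialStep]
        ring
      simp only [Function.comp, Real.dist_eq]
      rw [e, ← Real.norm_eq_abs]
      refine (intervalIntegral.norm_integral_le_of_norm_le_const fun s hs => ?_).trans
        (mul_le_mul_of_nonneg_right (Real.le_coe_toNNReal L) (abs_nonneg _))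
      rw [Real.norm_of_nonneg (H.nonneg _)]
      refine hL j s ?_
      have := (uIoc_subset_uIcc hs).2
      exact this.trans (max_le hy hx)
    exact hlip.continuousOn.continuousAt (Iic_mem_nhds (by
      have := le_abs_self r₀
      simp only [R]; linarith))
  have hflux : ∀ s, Tendsto (fun j => flux n (fun t => ρ t * f (W j t)) s) atTop
      (nhds (flux n (fun t => ρ t * f (w t)) s)) := by
    intro s
    unfold flux
    refine Tendsto.const_mul s ?_
    obtain ⟨A, hA⟩ := (isCompact_Icc (a := (0:ℝ)) (b := 1)).bddAbove_image
      (f := fun τ => ρ (s * τ)) (by fun_prop)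
    apply intervalIntegral.tendsto_integral_filter_of_dominated_convergence
      (fun _ => A * f (T |s|))
    · refine Eventually.of_forall fun j => Continuous.aestronglyMeasurable ?_
      have := hf.cont
      have := hWc j
      fun_prop
    · refine Eventually.of_forall fun j => Eventually.of_forall fun τ hτ => ?_
      rw [uIoc_of_le zero_le_one] at hτ
      have hτ0 := hτ.1.le
      have h1 := hf.nonneg (W j (s * τ))
      have h2 := hρ0 (s * τ)
      rw [Real.norm_of_nonneg (by positivity)]
      have h3 : s * τ ≤ |s| := by
        calc s * τ ≤ |s| * τ := by gcongr; exact le_abs_self s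
          _ ≤ |s| := mul_le_of_le_one_right (abs_nonneg s) hτ.2
      have h4 : ρ (s * τ) * f (W j (s * τ)) ≤ A * f (T |s|) :=
        mul_le_mul (hA (mem_image_of_mem (fun τ => ρ (s * τ)) ⟨hτ0, hτ.2⟩))
          (hf.mono (hT _ j _ h3)) h1
          (h2.trans (hA (mem_image_of_mem (fun τ => ρ (s * τ)) ⟨hτ0, hτ.2⟩)))
      exact (mul_le_of_le_one_left (by positivity) (pow_le_one₀ hτ0 hτ.2)).trans h4
    · simp
    · exact Eventually.of_forall fun τ _ =>
        (((hf.cont.tendsto _).comp (hlim (s * τ))).const_mul _).const_mul _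
  refine ⟨w, hwc, fun r => ?_⟩
  refine tendsto_nhds_unique ((hlim r).comp (tendsto_add_atTop_nat 1)) ?_
  change Tendsto (fun j => radialStep k f ρ n α (W j) r) atTop _
  unfold radialStep
  refine Tendsto.const_add α ?_
  obtain ⟨L, hL⟩ := hbound |r| (abs_nonneg r)
  apply intervalIntegral.tendsto_integral_filter_of_dominated_convergence (fun _ => L)
  · exact Eventually.of_forall fun j =>
      (continuous_kernel H hf n hρ (hWc j)).aestronglyMeasurable
  · refine Eventually.of_forall fun j => Eventually.of_forall fun s hs => ?_
    rw [Real.norm_of_nonneg (H.nonneg _)]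
    exact hL j s ((uIoc_subset_uIcc hs).2.trans (max_le (abs_nonneg r) (le_abs_self r)))
  · simp
  · exact Eventually.of_forall fun s _ => (H.cont.tendsto _).comp (hflux s)

/-- Radial profiles are unbounded when `∫ k (flux ρ)` diverges. -/
lemma radial_profile_unbounded (H : InversePair k Ψ) (hf : Nonlinearity f) (n : ℕ)
    (hρ : Continuous ρ) (hρ0 : ∀ t, 0 ≤ ρ t)
    (hA : ¬ IntegrableOn (fun s => k (flux n ρ s)) (Ioi 1)) {α : ℝ} (hα : 0 < α)
    {w : ℝ → ℝ} (hwc : Continuous w) (hw : ∀ r, w r = radialStep k f ρ n α w r) (M : ℝ) :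
    ∃ R ≥ 1, ∀ r ≥ R, M < w r := by
  obtain ⟨κ, hκ, hs⟩ := H.scale (f α) (hf.pos α hα)
  have hkc : Continuous fun s => k (flux n ρ s) := H.cont.comp (continuous_flux n hρ)
  obtain ⟨R, hR1, hR⟩ := exists_lt_integral_of_not_integrableOn hkc.continuousOn
    (fun t _ => H.nonneg _) hA (M / κ)
  refine ⟨R, hR1, fun r hr => ?_⟩
  have hr1 : 1 ≤ r := le_trans hR1 hr
  have h1 := hR r hr
  rw [div_lt_iff₀ hκ] at h1
  have hii := fun a b => (continuous_kernel H hf n hρ hwc).intervalIntegrable (μ := volume) a b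
  have h2 : (∫ s in (1:ℝ)..r, k (flux n ρ s)) * κ ≤
      ∫ s in (1:ℝ)..r, k (flux n (fun t => ρ t * f (w t)) s) := by
    rw [← intervalIntegral.integral_mul_const]
    apply intervalIntegral.integral_mono_on hr1
      ((hkc.mul continuous_const).intervalIntegrable _ _) (hii 1 r)
    intro s hs1
    have hs0 : 0 ≤ s := zero_le_one.trans hs1.1
    rw [mul_comm]
    refine (hs _ (flux_nonneg n hρ0 hs0)).trans (H.mono ?_)
    rw [← flux_const_mul]
    refine flux_mono n (continuous_const.mul hρ) (hρ.mul (hf.cont.comp hwc)) hs0 fun t _ => ?_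
    rw [mul_comm]
    have : α ≤ w t := (le_radialStep H hf n hρ0 α w t).trans (hw t).ge
    exact mul_le_mul_of_nonneg_left (hf.mono this) (hρ0 t)
  have h3 : 0 ≤ ∫ s in (0:ℝ)..1, k (flux n (fun t => ρ t * f (w t)) s) :=
    intervalIntegral.integral_nonneg zero_le_one fun s _ => H.nonneg _
  rw [hw r, radialStep, ← intervalIntegral.integral_add_adjacent_intervals (hii 0 1) (hii 1 r)]
  linarith

end Existence

section BlowUp

variable {k Ψ f ρ : ℝ → ℝ}

lemma exists_forall_mul_le_kernel (H : InversePair k Ψ) (hf : Nonlinearity f)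
    (hKO : IntegrableOn (koIntegrand Ψ f) (Ioi 1)) {c : ℝ} (hc : 0 < c) (B : ℝ) :
    ∃ T ≥ 1, ∀ t ≥ T, B * t ≤ k (c * f t) := by
  obtain ⟨M₀, hM₀, hM⟩ := H.superlinear c hc
  set M := max M₀ B
  have hMpos : 0 < M := by positivity
  obtain ⟨T, hT1, hT⟩ := exists_integral_lt_of_integrableOn hKO (ε := 1 / (2 * M)) (by positivity)
  refine ⟨2 * T, by linarith, fun t ht => ?_⟩
  have ht0 : 0 < t := by linarith
  have hF := hf.primitive_pos ht0
  refine (mul_le_mul_of_nonneg_right (le_max_right M₀ B) ht0.le).trans ?_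
  refine hM M (le_max_left _ _) t ht0 _ hF.le _ (hf.nonneg t) (hf.primitive_le ht0.le) ?_
  have h1 := hT (t / 2) t (by linarith) (by linarith)
  have h2 : ∫ s in (t / 2)..t, koIntegrand Ψ f t ≤ ∫ s in (t / 2)..t, koIntegrand Ψ f s := by
    apply intervalIntegral.integral_mono_on (by linarith) (by simp)
    · refine ((koIntegrand_continuousOn H hf).mono fun x hx => ?_).intervalIntegrable
      rw [uIcc_of_le (by linarith)] at hx
      exact lt_of_lt_of_le (by positivity) hx.1
    · intro s hs
      have hs0 : 0 < s := lt_of_lt_of_le (by positivity) hs.1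
      have hFs := hf.primitive_pos hs0
      exact one_div_le_one_div_of_le (H.posΨ _ hFs)
        (H.monoΨ hFs.le hF.le (hf.primitive_mono hs.2))
  rw [intervalIntegral.integral_const, smul_eq_mul, koIntegrand] at h2
  have hq := H.posΨ _ hF
  have h3 := h2.trans_lt h1
  have e : t - t / 2 = t / 2 := by ring
  rw [e, mul_one_div, div_lt_div_iff₀ hq (by positivity)] at h3
  linarith

/-- Under the Keller–Osserman condition the system `y' = k p`, `p' ≥ c f y` cannot be continued
over a given interval from large initial data. -/
lemma exists_no_large_solution (H : InversePair k Ψ) (hf : Nonlinearity f)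
    (hKO : IntegrableOn (koIntegrand Ψ f) (Ioi 1)) {a b c : ℝ} (hab : a < b) (hc : 0 < c) :
    ∃ M > 0, ∀ y p p' : ℝ → ℝ, (∀ r ∈ Icc a b, HasDerivAt y (k (p r)) r) →
      (∀ r ∈ Icc a b, HasDerivAt p (p' r) r) → (∀ r ∈ Icc a b, c * f (y r) ≤ p' r) →
      0 ≤ p a → y a < M := by
  set δ := (b - a) / 4 with hδdef
  have hδ : 0 < δ := by simp only [hδdef]; linarith
  obtain ⟨T₁, hT₁, hkT⟩ := exists_forall_mul_le_kernel H hf hKO (c := c * δ)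
    (by positivity) (1 / δ)
  obtain ⟨lam, hlam, hlow⟩ := H.lower (c / 2) (by positivity)
  obtain ⟨T₂, hT₂, htail⟩ := exists_integral_lt_of_integrableOn hKO
    (ε := lam * δ) (by positivity)
  refine ⟨max T₁ T₂, by positivity, fun y p p' hy hp hpf hpa => ?_⟩
  by_contra! hM
  have hyT₁ : T₁ ≤ y a := (le_max_left _ _).trans hM
  have hyT₂ : T₂ ≤ y a := (le_max_right _ _).trans hM
  have hya : 0 < y a := by linarith
  have hymono : ∀ r ∈ Icc a b, ∀ s ∈ Icc a b, r ≤ s → y r ≤ y s := by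
    intro r hr s hs hrs
    exact le_of_hasDerivAt_nonneg hrs
      (fun x hx => (hy x ⟨hr.1.trans hx.1, hx.2.trans hs.2⟩).continuousAt.continuousWithinAt)
      (fun x hx => hy x ⟨hr.1.trans hx.1.le, hx.2.le.trans hs.2⟩) (fun x _ => H.nonneg _)
  have haI : a ∈ Icc a b := ⟨le_rfl, hab.le⟩
  have hplin : ∀ r ∈ Icc a b, c * f (y a) * (r - a) ≤ p r := by
    intro r hr
    have := le_of_hasDerivAt_nonneg hr.1 (D := fun r => p r - c * f (y a) * (r - a))
      (D' := fun r => p' r - c * f (y a) * 1)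
      (fun x hx => ((hp x ⟨hx.1, hx.2.trans hr.2⟩).sub
        (((hasDerivAt_id x).sub_const a).const_mul _)).continuousAt.continuousWithinAt)
      (fun x hx => (hp x ⟨hx.1.le, hx.2.le.trans hr.2⟩).sub
        (((hasDerivAt_id x).sub_const a).const_mul _))
      (fun x hx => by
        have hx' : x ∈ Icc a b := ⟨hx.1.le, hx.2.le.trans hr.2⟩
        have h1 := hpf x hx'
        have h2 := hf.mono (hymono a haI x hx' hx.1.le)
        nlinarith)
    simp only [sub_self, mul_zero, sub_zero] at this
    linarith
  have hp0 : ∀ r ∈ Icc a b, 0 ≤ p r := fun r hr =>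
    le_trans (mul_nonneg (mul_nonneg hc.le (hf.nonneg _)) (sub_nonneg.2 hr.1)) (hplin r hr)
  have hdouble : 2 * y a ≤ y (a + 2 * δ) := by
    have h1I : a + δ ∈ Icc a b := ⟨by linarith, by simp only [hδdef]; linarith⟩
    have h2I : a + 2 * δ ∈ Icc a b := ⟨by linarith, by simp only [hδdef]; linarith⟩
    have := le_of_hasDerivAt_nonneg (a := a + δ) (b := a + 2 * δ) (by linarith)
      (D := fun r => y r - 1 / δ * y a * r) (D' := fun r => k (p r) - 1 / δ * y a * 1)
      (fun x hx => ((hy x ⟨h1I.1.trans hx.1, hx.2.trans h2I.2⟩).sub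
        ((hasDerivAt_id x).const_mul _)).continuousAt.continuousWithinAt)
      (fun x hx => (hy x ⟨h1I.1.trans hx.1.le, hx.2.le.trans h2I.2⟩).sub
        ((hasDerivAt_id x).const_mul _))
      (fun x hx => by
        have hx' : x ∈ Icc a b := ⟨h1I.1.trans hx.1.le, hx.2.le.trans h2I.2⟩
        have h1 := hkT _ hyT₁
        have h2 : c * δ * f (y a) ≤ p x := by
          refine le_trans ?_ (hplin x hx')
          have := mul_nonneg hc.le (hf.nonneg (y a))
          nlinarith [hx.1]
        have := h1.trans (H.mono h2)
        linarith)
    have h3 := hymono a haI _ h1I (by linarith)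
    have h4 : 1 / δ * y a * (a + 2 * δ) - 1 / δ * y a * (a + δ) = y a := by
      field_simp; ring
    linarith
  have hKd : ∀ v, HasDerivAt (fun v => ∫ x in (0:ℝ)..v, k x) (k v) v :=
    hasDerivAt_primitive H.cont 0
  have hFd : ∀ v, HasDerivAt (fun v => ∫ x in (0:ℝ)..v, f x) (f v) v :=
    hasDerivAt_primitive hf.cont 0
  have henergy : ∀ r ∈ Icc a b, c * ((∫ x in (0:ℝ)..(y r), f x) - ∫ x in (0:ℝ)..(y a), f x) ≤
      ∫ x in (0:ℝ)..(p r), k x := by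
    intro r hr
    have := le_of_hasDerivAt_nonneg hr.1
      (D := fun r => (∫ x in (0:ℝ)..(p r), k x) - c * ∫ x in (0:ℝ)..(y r), f x)
      (D' := fun r => k (p r) * p' r - c * (f (y r) * k (p r)))
      (fun x hx => (((hKd _).comp x (hp x ⟨hx.1, hx.2.trans hr.2⟩)).sub
        (((hFd _).comp x (hy x ⟨hx.1, hx.2.trans hr.2⟩)).const_mul
          c)).continuousAt.continuousWithinAt)
      (fun x hx => ((hKd _).comp x (hp x ⟨hx.1.le, hx.2.le.trans hr.2⟩)).sub
        (((hFd _).comp x (hy x ⟨hx.1.le, hx.2.le.trans hr.2⟩)).const_mul c))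
      (fun x hx => by
        have h1 := hpf x ⟨hx.1.le, hx.2.le.trans hr.2⟩
        have h2 := H.nonneg (p x)
        nlinarith)
    have h0 : 0 ≤ ∫ x in (0:ℝ)..(p a), k x :=
      intervalIntegral.integral_nonneg hpa fun x _ => H.nonneg x
    linarith
  have h2I : a + 2 * δ ∈ Icc a b := ⟨by linarith, by simp only [hδdef]; linarith⟩
  have hle := le_of_hasDerivAt_nonneg h2I.2
    (D := fun r => (∫ t in (1:ℝ)..(y r), koIntegrand Ψ f t) - lam * r)
    (D' := fun r => koIntegrand Ψ f (y r) * k (p r) - lam * 1)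
    (fun x hx => by
      have hx' : x ∈ Icc a b := ⟨h2I.1.trans hx.1, hx.2⟩
      exact (((hasDerivAt_integral_koIntegrand H hf one_pos
        (hya.trans_le (hymono a haI x hx' hx'.1))).comp x (hy x hx')).sub
        ((hasDerivAt_id x).const_mul lam)).continuousAt.continuousWithinAt)
    (fun x hx => by
      have hx' : x ∈ Icc a b := ⟨h2I.1.trans hx.1.le, hx.2.le⟩
      exact ((hasDerivAt_integral_koIntegrand H hf one_pos
        (hya.trans_le (hymono a haI x hx' hx'.1))).comp x (hy x hx')).sub
        ((hasDerivAt_id x).const_mul lam))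
    (fun x hx => by
      have hx' : x ∈ Icc a b := ⟨h2I.1.trans hx.1.le, hx.2.le⟩
      have hyx : 2 * y a ≤ y x := hdouble.trans (hymono _ h2I x hx' hx.1.le)
      have hF := hf.primitive_pos (show 0 < y x by linarith)
      have h1 := hf.two_mul_primitive_le hya.le hyx
      have h2 := hlow _ (hp0 x hx') _ hF.le (by
        refine le_trans ?_ (henergy x hx')
        nlinarith)
      have h3 := H.posΨ _ hF
      rw [koIntegrand, one_div_mul_eq_div, sub_nonneg, le_div_iff₀ h3]
      linarith)
  have hy2 : y a ≤ y (a + 2 * δ) := hymono a haI _ h2I h2I.1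
  have hyb : y (a + 2 * δ) ≤ y b := hymono _ h2I b ⟨hab.le, le_rfl⟩ h2I.2
  have ht := htail (y (a + 2 * δ)) (y b) (hyT₂.trans hy2) hyb
  have hii : ∀ x ≥ 1, IntervalIntegrable (koIntegrand Ψ f) volume 1 x := fun x hx =>
    (intervalIntegrable_iff_integrableOn_Ioc_of_le hx).2 (hKO.mono_set Ioc_subset_Ioi_self)
  rw [← intervalIntegral.integral_interval_sub_left (hii _ (by linarith)) (hii _ (by linarith))]
    at ht
  have : b = a + 4 * δ := by simp only [hδdef]; ring
  have h5 : lam * b = lam * (a + 2 * δ) + 2 * (lam * δ) := by rw [this]; ring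
  have := mul_pos hlam hδ
  linarith

/-- Under the Keller–Osserman condition, radial profiles are bounded at the left end of any
interval where the weight is positive. -/
lemma exists_profile_bound (H : InversePair k Ψ) (hf : Nonlinearity f) (n : ℕ)
    (hKO : IntegrableOn (koIntegrand Ψ f) (Ioi 1)) (hρ : Continuous ρ) (hρ0 : ∀ t, 0 ≤ ρ t)
    {a b c : ℝ} (ha : 0 < a) (hab : a < b) (hc : 0 < c) (hρc : ∀ t ∈ Icc a b, c ≤ ρ t) :
    ∃ M, ∀ w : ℝ → ℝ, Continuous w →
      (∀ r > 0, HasDerivAt w (k (flux n (fun t => ρ t * f (w t)) r)) r) → w 0 ≤ M := by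
  have hb : 0 < b := ha.trans hab
  obtain ⟨M, hM0, hM⟩ := exists_no_large_solution H hf hKO hab
    (c := a ^ n * c / b ^ n) (by positivity)
  refine ⟨M, fun w hwc hwd => ?_⟩
  set g : ℝ → ℝ := fun t => ρ t * f (w t) with hg
  have hgc : Continuous g := hρ.mul (hf.cont.comp hwc)
  have hg0 : ∀ t, 0 ≤ g t := fun t => mul_nonneg (hρ0 t) (hf.nonneg _)
  have hPc : Continuous fun t => t ^ n * g t := by fun_prop
  set p : ℝ → ℝ := fun r => (∫ t in (0:ℝ)..r, t ^ n * g t) / b ^ n with hp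
  have hpd : ∀ r, HasDerivAt p (r ^ n * g r / b ^ n) r := fun r =>
    (hasDerivAt_primitive hPc 0 r).div_const _
  have hpc : Continuous p := continuous_iff_continuousAt.2 fun r => (hpd r).continuousAt
  set y : ℝ → ℝ := fun r => w a + ∫ s in a..r, k (p s) with hy
  have hyd : ∀ r, HasDerivAt y (k (p r)) r := fun r =>
    (hasDerivAt_primitive (H.cont.comp hpc) a r).const_add _
  have hple : ∀ r ∈ Icc a b, p r ≤ flux n g r := by
    intro r hr
    have hr0 : 0 < r := ha.trans_le hr.1
    simp only [hp]
    rw [← pow_mul_flux, div_le_iff₀ (by positivity), mul_comm]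
    have := flux_nonneg n hg0 hr0.le
    have := hr.2
    gcongr
  have hyw : ∀ r ∈ Icc a b, y r ≤ w r := by
    intro r hr
    have := le_of_hasDerivAt_nonneg hr.1 (D := fun r => w r - y r)
      (D' := fun r => k (flux n g r) - k (p r))
      (fun x hx => ((hwd x (ha.trans_le hx.1)).sub (hyd x)).continuousAt.continuousWithinAt)
      (fun x hx => (hwd x (ha.trans hx.1)).sub (hyd x))
      (fun x hx => sub_nonneg.2 (H.mono (hple x ⟨hx.1.le, hx.2.le.trans hr.2⟩)))
    simp only [hy, intervalIntegral.integral_same] at this ⊢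
    linarith
  have hlt := hM y p (fun r => r ^ n * g r / b ^ n) (fun r _ => hyd r) (fun r _ => hpd r)
    (fun r hr => by
      have h1 := hf.mono (hyw r hr)
      have h2 := hρc r hr
      have h3 := hf.nonneg (y r)
      have h4 := hr.1
      have h5 := hρ0 r
      have h6 : 0 ≤ r := ha.le.trans hr.1
      simp only [hg]
      rw [div_mul_eq_mul_div, mul_assoc]
      gcongr)
    (div_nonneg (intervalIntegral.integral_nonneg ha.le fun t ht =>
      mul_nonneg (pow_nonneg ht.1 _) (hg0 t)) (by positivity))
  have hya : y a = w a := by simp [hy]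
  rw [hya] at hlt
  have := le_of_hasDerivAt_nonneg ha.le hwc.continuousOn (fun x hx => hwd x hx.1)
    (fun x _ => H.nonneg _)
  linarith

end BlowUp

section Radial

variable {E : Type*} [NormedAddCommGroup E] [InnerProductSpace ℝ E]

lemma continuous_radial_field {p : ℝ → ℝ} (hp : Continuous p) (hp0 : p 0 = 0) :
    Continuous fun x : E => (p ‖x‖ / ‖x‖) • x := by
  rw [continuous_iff_continuousAt]
  intro x
  by_cases hx : x = 0
  · subst hx
    rw [ContinuousAt, smul_zero, tendsto_zero_iff_norm_tendsto_zero]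
    have h1 : Tendsto (fun x : E => |p ‖x‖|) (nhds 0) (nhds 0) := by
      have : Continuous fun x : E => |p ‖x‖| := by fun_prop
      simpa [hp0] using this.tendsto 0
    refine squeeze_zero (fun _ => norm_nonneg _) (fun y => ?_) h1
    rw [norm_smul, norm_div, norm_norm, Real.norm_eq_abs]
    rcases eq_or_ne ‖y‖ 0 with hy | hy
    · simp [hy]
    · rw [div_mul_cancel₀ _ hy]
  · exact ((hp.continuousAt.comp continuous_norm.continuousAt).div
      continuous_norm.continuousAt (norm_ne_zero_iff.2 hx)).smul continuousAt_id

variable [FiniteDimensional ℝ E]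

lemma hasGradientAt_comp_norm {w : ℝ → ℝ} {p : ℝ} {x : E} (hx : x ≠ 0)
    (hw : HasDerivAt w p ‖x‖) : HasGradientAt (fun y : E => w ‖y‖) ((p / ‖x‖) • x) x := by
  have hx' : ‖x‖ ≠ 0 := norm_ne_zero_iff.2 hx
  have h1 := (hasStrictFDerivAt_norm_sq x).hasFDerivAt.sqrt (pow_ne_zero 2 hx')
  simp only [Real.sqrt_sq (norm_nonneg _)] at h1
  have h2 := hw.comp_hasFDerivAt x h1
  rw [hasGradientAt_iff_hasFDerivAt]
  refine h2.congr_fderiv ?_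
  ext y
  simp
  field_simp

lemma hasGradientAt_comp_norm_zero {w : ℝ → ℝ} (hw : HasDerivAt w 0 0) :
    HasGradientAt (fun y : E => w ‖y‖) 0 (0 : E) := by
  rw [hasGradientAt_iff_isLittleO_nhds_zero]
  rw [hasDerivAt_iff_isLittleO_nhds_zero] at hw
  have := hw.comp_tendsto (tendsto_norm_zero (E := E))
  simp only [zero_add, smul_zero, sub_zero, Function.comp_def] at this
  simpa using Asymptotics.isLittleO_norm_right.1 this

lemma hasGradientAt_radial {w p : ℝ → ℝ} (hp0 : p 0 = 0) (hw : ∀ r, HasDerivAt w (p r) r)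
    (x : E) : HasGradientAt (fun y : E => w ‖y‖) ((p ‖x‖ / ‖x‖) • x) x := by
  by_cases hx : x = 0
  · subst hx
    rw [smul_zero]
    exact hasGradientAt_comp_norm_zero (by have := hw 0; rwa [hp0] at this)
  · exact hasGradientAt_comp_norm hx (hw _)

lemma contDiff_radial {w p : ℝ → ℝ} (hp : Continuous p) (hp0 : p 0 = 0)
    (hw : ∀ r, HasDerivAt w (p r) r) : ContDiff ℝ 1 fun x : E => w ‖x‖ := by
  rw [contDiff_one_iff_hasFDerivAt]
  exact ⟨fun x => InnerProductSpace.toDual ℝ E ((p ‖x‖ / ‖x‖) • x),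
    (InnerProductSpace.toDual ℝ E).continuous.comp (continuous_radial_field hp hp0),
    fun x => (hasGradientAt_radial hp0 hw x).hasFDerivAt⟩

variable [MeasurableSpace E] [BorelSpace E]

lemma integral_eq_zero_of_radial_integral_eq_zero [Nontrivial E]
    (μ : Measure E) [μ.IsAddHaarMeasure] {G : E → ℝ}
    (h : ∀ ω : E, ‖ω‖ = 1 →
      ∫ r in Ioi (0:ℝ), r ^ (Module.finrank ℝ E - 1) * G (r • ω) = 0) :
    ∫ x, G x ∂μ = 0 := by
  have hmp := μ.measurePreserving_homeomorphUnitSphereProd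
  have e1 : ∫ x, G x ∂μ = ∫ q : Metric.sphere (0 : E) 1 × Ioi (0:ℝ), G (q.2.1 • q.1.1)
      ∂μ.toSphere.prod (.volumeIoiPow (Module.finrank ℝ E - 1)) := by
    have h0 : ∫ x, G x ∂μ = ∫ x : ({(0 : E)}ᶜ : Set E), G x.1 ∂(μ.comap (↑)) := by
      rw [integral_subtype_comap (measurableSet_singleton (0 : E)).compl G,
        restrict_compl_singleton]
    rw [h0, ← hmp.integral_comp (Homeomorph.measurableEmbedding _)]
    refine integral_congr_ae (Eventually.of_forall fun x => ?_)
    have hx : ‖x.1‖ ≠ 0 := norm_ne_zero_iff.2 x.2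
    simp [smul_smul, hx]
  rw [e1]
  by_cases hi : Integrable (fun q : Metric.sphere (0 : E) 1 × Ioi (0:ℝ) => G (q.2.1 • q.1.1))
      (μ.toSphere.prod (.volumeIoiPow (Module.finrank ℝ E - 1)))
  · rw [integral_prod _ hi]
    refine integral_eq_zero_of_ae (Eventually.of_forall fun ω => ?_)
    have hω : ‖ω.1‖ = 1 := by simp
    simp only [Measure.volumeIoiPow, ENNReal.ofReal, Pi.zero_apply]
    refine Eq.trans ?_ (h ω.1 hω)
    rw [integral_withDensity_eq_integral_smul,
      integral_subtype_comap measurableSet_Ioi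
        fun a ↦ Real.toNNReal (a ^ (Module.finrank ℝ E - 1)) • G (a • ω.1)]
    · refine setIntegral_congr_fun measurableSet_Ioi fun x hx => ?_
      simp only [NNReal.smul_def, Real.coe_toNNReal _ (pow_nonneg (mem_Ioi.1 hx).le _),
        smul_eq_mul]
    · exact (measurable_subtype_coe.pow_const _).real_toNNReal
  · exact integral_undef hi

/-- A radial field `V(|x|) x/|x|` with `rⁿ V(r) = ∫₀ʳ tⁿ g` has weak divergence `g(|x|)`. -/
lemma weak_divergence_radial [Nontrivial E] (μ : Measure E) [μ.IsAddHaarMeasure]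
    {V g : ℝ → ℝ} (hV : Continuous V) (hV0 : V 0 = 0) (hg : Continuous g)
    (hVg : ∀ r, r ^ (Module.finrank ℝ E - 1) * V r =
      ∫ t in (0:ℝ)..r, t ^ (Module.finrank ℝ E - 1) * g t)
    {ψ : E → ℝ} (hψ : ContDiff ℝ 1 ψ) (hψc : HasCompactSupport ψ) :
    (∫ x, fderiv ℝ ψ x ((V ‖x‖ / ‖x‖) • x) ∂μ) + ∫ x, g ‖x‖ * ψ x ∂μ = 0 := by
  set d := Module.finrank ℝ E - 1 with hd
  have hX := continuous_radial_field (E := E) hV hV0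
  have hfd : Continuous (fderiv ℝ ψ) := hψ.continuous_fderiv one_ne_zero
  have hi1 : Integrable (fun x => fderiv ℝ ψ x ((V ‖x‖ / ‖x‖) • x)) μ := by
    apply Continuous.integrable_of_hasCompactSupport (hfd.clm_apply hX)
    refine (hψc.fderiv (𝕜 := ℝ)).mono fun x hx => ?_
    rw [Function.mem_support] at hx ⊢
    rintro h
    rw [h] at hx
    simp at hx
  have hi2 : Integrable (fun x => g ‖x‖ * ψ x) μ := by
    have := hψ.continuous
    exact Continuous.integrable_of_hasCompactSupport (by fun_prop) hψc.mul_left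
  rw [← integral_add hi1 hi2]
  apply integral_eq_zero_of_radial_integral_eq_zero
  intro ω hω
  have hP : Continuous fun t => t ^ d * g t := by fun_prop
  set P : ℝ → ℝ := fun r => ∫ t in (0:ℝ)..r, t ^ d * g t with hPdef
  have hPd : ∀ r, HasDerivAt P (r ^ d * g r) r := hasDerivAt_primitive hP 0
  have hPC : ContDiff ℝ 1 P := by
    rw [contDiff_one_iff_deriv]
    refine ⟨fun r => (hPd r).differentiableAt, ?_⟩
    rw [show deriv P = fun r => r ^ d * g r from funext fun r => (hPd r).deriv]
    exact hP
  have hline : ∀ r, HasDerivAt (fun r : ℝ => ψ (r • ω)) (fderiv ℝ ψ (r • ω) ω) r := by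
    intro r
    have h1 : HasDerivAt (fun r : ℝ => r • ω) ω r := by
      simpa using (hasDerivAt_id r).smul_const ω
    exact ((hψ.differentiable one_ne_zero) (r • ω)).hasFDerivAt.comp_hasDerivAt r h1
  have hS : HasCompactSupport fun r => P r * ψ (r • ω) := by
    obtain ⟨R, hR⟩ := hψc.isCompact.isBounded.subset_closedBall 0
    refine HasCompactSupport.intro (isCompact_closedBall (0:ℝ) R) fun r hr => ?_
    have : ψ (r • ω) = 0 := by
      by_contra hne
      have := hR (subset_tsupport ψ (Function.mem_support.2 hne))
      rw [mem_closedBall_zero_iff, norm_smul, hω, mul_one] at this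
      exact hr (mem_closedBall_zero_iff.2 this)
    simp [this]
  have hC : ContDiff ℝ 1 fun r => P r * ψ (r • ω) :=
    hPC.mul (hψ.comp (contDiff_id.smul contDiff_const))
  have hint := HasCompactSupport.integral_Ioi_deriv_eq hC hS 0
  have hP0 : P 0 = 0 := by simp [hPdef]
  rw [hP0, zero_mul, neg_zero] at hint
  refine Eq.trans ?_ hint
  refine setIntegral_congr_fun measurableSet_Ioi fun r hr => ?_
  have hr0 : 0 < r := hr
  have hder : deriv (fun r => P r * ψ (r • ω)) r = _ := ((hPd r).mul (hline r)).deriv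
  rw [hder, norm_smul, hω, mul_one, Real.norm_of_nonneg hr0.le,
    smul_smul, div_mul_cancel₀ _ hr0.ne', map_smul, smul_eq_mul,
    show P r = r ^ d * V r from (hVg r).symm, ← hd]
  ring

/-- Conversely, the weak divergence identity for a radial field determines its flux. -/
lemma flux_eq_of_weak_divergence_radial [Nontrivial E] (μ : Measure E) [μ.IsAddHaarMeasure]
    {V g : ℝ → ℝ} (hV : Continuous V) (hg : Continuous g)
    (hweak : ∀ ψ : E → ℝ, ContDiff ℝ (⊤ : ℕ∞) ψ → HasCompactSupport ψ →
      (∫ x, fderiv ℝ ψ x ((V ‖x‖ / ‖x‖) • x) ∂μ) + ∫ x, g ‖x‖ * ψ x ∂μ = 0) :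
    ∀ r > 0, r ^ (Module.finrank ℝ E - 1) * V r =
      ∫ t in (0:ℝ)..r, t ^ (Module.finrank ℝ E - 1) * g t := by
  set d := Module.finrank ℝ E - 1 with hd
  have hP : Continuous fun t => t ^ d * g t := by fun_prop
  set P : ℝ → ℝ := fun r => ∫ t in (0:ℝ)..r, t ^ d * g t with hPdef
  have hPd : ∀ r, HasDerivAt P (r ^ d * g r) r := hasDerivAt_primitive hP 0
  have hPc : Continuous P := continuous_iff_continuousAt.2 fun r => (hPd r).continuousAt
  have hcont : Continuous fun r => r ^ d * V r - P r := by fun_prop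
  have hae : ∀ᵐ r ∂(volume : Measure ℝ), r ∈ Ioi (0:ℝ) → r ^ d * V r - P r = 0 := by
    refine isOpen_Ioi.ae_eq_zero_of_integral_contDiff_smul_eq_zero
      (hcont.locallyIntegrable.locallyIntegrableOn _) fun ξ hξ hξc hξs => ?_
    obtain ⟨R, hR⟩ := hξc.isCompact.isBounded.subset_closedBall 0
    set b := max R 1 with hb
    have hb0 : 0 < b := by positivity
    have hξb : ∀ r, b ≤ r → ξ r = 0 ∨ r ≤ b := by
      intro r hr
      by_contra! hne
      have := hR (subset_tsupport ξ (Function.mem_support.2 hne.1))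
      rw [mem_closedBall_zero_iff, Real.norm_eq_abs] at this
      have h1 := le_abs_self r
      have h2 : R ≤ b := le_max_left _ _
      linarith [hne.2]
    have hξneg : ∀ r ≤ 0, ξ r = 0 := by
      intro r hr
      by_contra hne
      have : 0 < r := hξs (subset_tsupport ξ (Function.mem_support.2 hne))
      linarith
    have hξgt : ∀ r > b, ξ r = 0 := fun r hr =>
      (hξb r hr.le).resolve_right (not_le.2 hr)
    set η : ℝ → ℝ := fun r => ∫ s in b..r, ξ s with hη
    have hηd : ∀ r, HasDerivAt η (ξ r) r := hasDerivAt_primitive hξ.continuous b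
    have hηs : ContDiff ℝ (⊤ : ℕ∞) η := by
      rw [contDiff_infty_iff_deriv]
      refine ⟨fun r => (hηd r).differentiableAt, ?_⟩
      rw [show deriv η = ξ from funext fun r => (hηd r).deriv]
      exact hξ
    have hηc : Continuous η := hηs.continuous
    have hηb : ∀ r ≥ b, η r = 0 := by
      intro r hr
      have : ∫ s in b..r, ξ s = ∫ s in b..r, (0:ℝ) := by
        apply intervalIntegral.integral_congr_ae
        refine Eventually.of_forall fun s hs => ?_
        rw [uIoc_of_le hr] at hs
        exact hξgt s hs.1
      simp [hη, this]
    have hη0 : ∀ᶠ r in nhds 0, η r = η 0 := by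
      have h0 : (0:ℝ) ∉ tsupport ξ := fun h => lt_irrefl _ (mem_Ioi.1 (hξs h))
      have h1 : (tsupport ξ)ᶜ ∈ nhds (0:ℝ) := (isClosed_tsupport ξ).isOpen_compl.mem_nhds h0
      obtain ⟨ε, hε, hball⟩ := Metric.mem_nhds_iff.1 h1
      filter_upwards [Metric.ball_mem_nhds (0:ℝ) hε] with r hr
      have hz : ∫ s in (0:ℝ)..r, ξ s = 0 := by
        have : ∫ s in (0:ℝ)..r, ξ s = ∫ s in (0:ℝ)..r, (0:ℝ) := by
          apply intervalIntegral.integral_congr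
          intro s hs
          apply image_eq_zero_of_notMem_tsupport
          apply hball
          exact (convex_ball (0:ℝ) ε).ordConnected.uIcc_subset (Metric.mem_ball_self hε) hr hs
        simpa using this
      have := intervalIntegral.integral_add_adjacent_intervals (μ := volume)
        (hξ.continuous.intervalIntegrable b 0) (hξ.continuous.intervalIntegrable 0 r)
      simp only [hη]
      rw [← this, hz, add_zero]
    have hψs : ContDiff ℝ (⊤ : ℕ∞) fun x : E => η ‖x‖ := by
      rw [contDiff_iff_contDiffAt]
      intro x
      by_cases hx : x = 0
      · subst hx
        refine (contDiffAt_const (c := η 0)).congr_of_eventuallyEq ?_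
        exact (tendsto_norm_zero (E := E)).eventually hη0
      · exact hηs.contDiffAt.comp x (contDiffAt_norm ℝ hx)
    have hψc : HasCompactSupport fun x : E => η ‖x‖ := by
      refine HasCompactSupport.intro (isCompact_closedBall (0:E) b) fun x hx => ?_
      rw [mem_closedBall_zero_iff, not_le] at hx
      exact hηb _ hx.le
    have hw := hweak _ hψs hψc
    have e1 : ∀ x : E, fderiv ℝ (fun x : E => η ‖x‖) x ((V ‖x‖ / ‖x‖) • x)
        = ξ ‖x‖ * V ‖x‖ := by
      intro x
      by_cases hx : x = 0
      · subst hx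
        simp [hξneg 0 le_rfl]
      · have hx' : ‖x‖ ≠ 0 := norm_ne_zero_iff.2 hx
        rw [(hasGradientAt_comp_norm hx (hηd ‖x‖)).fderiv_apply, inner_smul_left,
          inner_smul_right, real_inner_self_eq_norm_sq]
        simp only [conj_trivial]
        field_simp
    simp only [e1] at hw
    rw [integral_fun_norm_addHaar μ (fun r => ξ r * V r),
      integral_fun_norm_addHaar μ (fun r => g r * η r), ← smul_add, ← smul_add] at hw
    have hvol : μ.real (Metric.ball (0:E) 1) ≠ 0 :=
      (ENNReal.toReal_pos (Metric.measure_ball_pos μ 0 one_pos).ne' measure_ball_lt_top.ne).ne'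
    have hdim : Module.finrank ℝ E ≠ 0 := Module.finrank_pos.ne'
    have hw2 := (smul_eq_zero.1 ((smul_eq_zero.1 hw).resolve_left hdim)).resolve_left hvol
    simp only [smul_eq_mul] at hw2
    have trunc : ∀ G : ℝ → ℝ, (∀ r > b, G r = 0) →
        ∫ r in Ioi (0:ℝ), G r = ∫ r in (0:ℝ)..b, G r := by
      intro G hG
      rw [intervalIntegral.integral_of_le hb0.le]
      refine (setIntegral_eq_of_subset_of_forall_sdiff_eq_zero measurableSet_Ioi
        (fun r hr => hr.1) fun r hr => hG r ?_)
      by_contra hcon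
      exact hr.2 ⟨hr.1, not_lt.1 hcon⟩
    rw [trunc _ (fun r hr => by rw [hξgt r hr]; ring),
      trunc _ (fun r hr => by rw [hηb r hr.le]; ring)] at hw2
    have hparts := intervalIntegral.integral_mul_deriv_eq_deriv_mul (a := 0) (b := b)
      (u := P) (v := η) (u' := fun r => r ^ d * g r) (v' := ξ)
      (fun r _ => hPd r) (fun r _ => hηd r) (hP.intervalIntegrable _ _)
      (hξ.continuous.intervalIntegrable _ _)
    have hP0 : P 0 = 0 := by simp [hPdef]
    rw [hηb b le_rfl, hP0] at hparts
    have hfull : ∫ r, ξ r • (r ^ d * V r - P r) = ∫ r in (0:ℝ)..b, ξ r * (r ^ d * V r - P r) := by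
      rw [← trunc _ (fun r hr => by rw [hξgt r hr]; ring)]
      symm
      refine setIntegral_eq_integral_of_forall_compl_eq_zero fun r hr => ?_
      rw [hξneg r (not_lt.1 hr), zero_mul]
    have hξcont := hξ.continuous
    rw [hfull]
    have hsplit : ∫ r in (0:ℝ)..b, ξ r * (r ^ d * V r - P r) =
        (∫ r in (0:ℝ)..b, r ^ d * (ξ r * V r)) - ∫ r in (0:ℝ)..b, P r * ξ r := by
      rw [← intervalIntegral.integral_sub
        ((by fun_prop : Continuous fun r => r ^ d * (ξ r * V r)).intervalIntegrable _ _)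
        ((by fun_prop : Continuous fun r => P r * ξ r).intervalIntegrable _ _)]
      apply intervalIntegral.integral_congr
      intro r _
      simp only
      ring
    have e2 : ∫ r in (0:ℝ)..b, r ^ d * (g r * η r) = ∫ r in (0:ℝ)..b, r ^ d * g r * η r := by
      simp only [mul_assoc]
    rw [hsplit]
    rw [e2] at hw2
    linarith
  have heq : EqOn (fun r => r ^ d * V r - P r) (fun _ => 0) (Ioi 0) := by
    apply Measure.eqOn_open_of_ae_eq (μ := volume) _ isOpen_Ioi hcont.continuousOn
      continuousOn_const
    rw [Filter.EventuallyEq, ae_restrict_iff' measurableSet_Ioi]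
    exact hae
  intro r hr
  exact sub_eq_zero.1 (heq hr)

end Radial

section RadialSolutions

variable {E : Type*} [NormedAddCommGroup E] [InnerProductSpace ℝ E] [FiniteDimensional ℝ E]

lemma mul_inner_gradient_radial (φ : ℝ → ℝ) {u : E → ℝ} (ψ : E → ℝ) {p : ℝ} {x : E}
    (hu : HasGradientAt u ((p / ‖x‖) • x) x) :
    φ ‖gradient u x‖ * ⟪gradient u x, gradient ψ x⟫ =
      fderiv ℝ ψ x ((φ |p| * p / ‖x‖) • x) := by
  rw [hu.gradient, inner_gradient_right, conj_trivial, map_smul, map_smul]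
  by_cases hx : x = 0
  · simp [hx]
  · rw [norm_smul, norm_div, norm_norm, Real.norm_eq_abs,
      div_mul_cancel₀ _ (norm_ne_zero_iff.2 hx), smul_eq_mul, smul_eq_mul]
    ring

variable [MeasurableSpace E] [BorelSpace E] [Nontrivial E]

/-- A profile solving `w' = h⁻¹(V)`, where `V` is the flux of `g`, gives a weak solution of
`Δ_φ u = g(|x|)`. -/
lemma weak_solution_of_profile (μ : Measure E) [μ.IsAddHaarMeasure] {φ hfun hinv : ℝ → ℝ}
    (hh0 : hfun 0 = 0) (hhdef : ∀ t > 0, hfun t = φ t * t)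
    (hinv_nonneg : ∀ t ≥ 0, 0 ≤ hinv t) (hinv_left : ∀ t ≥ 0, hinv (hfun t) = t)
    (hinv_right : ∀ t ≥ 0, hfun (hinv t) = t)
    {w g : ℝ → ℝ} (hg : Continuous g) (hg0 : ∀ t, 0 ≤ g t)
    (hw : ∀ r, HasDerivAt w (hinv (max (flux (Module.finrank ℝ E - 1) g r) 0)) r)
    {ψ : E → ℝ} (hψ : ContDiff ℝ 1 ψ) (hψc : HasCompactSupport ψ) :
    (∫ x : E, φ ‖gradient (fun y : E => w ‖y‖) x‖ *
        ⟪gradient (fun y : E => w ‖y‖) x, gradient ψ x⟫ ∂μ) + ∫ x, g ‖x‖ * ψ x ∂μ = 0 := by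
  set V := flux (Module.finrank ℝ E - 1) g with hV
  have hV0 : V 0 = 0 := flux_zero _ _
  have hinv0 : hinv 0 = 0 := by simpa [hh0] using hinv_left 0 le_rfl
  rw [← weak_divergence_radial μ (continuous_flux _ hg) hV0 hg (pow_mul_flux _ g) hψ hψc]
  congr 2
  funext x
  rw [mul_inner_gradient_radial φ ψ (hasGradientAt_radial (by simp [hV0, hinv0]) hw x)]
  have hVx : 0 ≤ V ‖x‖ := flux_nonneg _ hg0 (norm_nonneg x)
  have hp := hinv_nonneg _ hVx
  have hr := hinv_right _ hVx
  rw [max_eq_left hVx, abs_of_nonneg hp]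
  congr 3
  rcases hp.eq_or_lt with h | h
  · rw [← h, hh0] at hr
    rw [← h, mul_zero, hr]
  · rw [← hhdef _ h, hr]

/-- The profile of a radial weak solution of `Δ_φ u = g(|x|)` solves `w' = h⁻¹(V)`, where `V` is
the flux of `g`. -/
lemma profile_of_weak_solution (μ : Measure E) [μ.IsAddHaarMeasure] {φ hfun hinv : ℝ → ℝ}
    (hφpos : ∀ t > 0, 0 < φ t)
    (hh0 : hfun 0 = 0) (hhdef : ∀ t > 0, hfun t = φ t * t)
    (hcont : Continuous fun v => hfun (max v 0)) (hinv_left : ∀ t ≥ 0, hinv (hfun t) = t)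
    {w g : ℝ → ℝ} (hg : Continuous g) (hg0 : ∀ t, 0 ≤ g t)
    (hu : ContDiff ℝ 1 fun x : E => w ‖x‖)
    (hweak : ∀ ψ : E → ℝ, ContDiff ℝ (⊤ : ℕ∞) ψ → HasCompactSupport ψ →
      (∫ x : E, φ ‖gradient (fun y : E => w ‖y‖) x‖ *
        ⟪gradient (fun y : E => w ‖y‖) x, gradient ψ x⟫ ∂μ) + ∫ x, g ‖x‖ * ψ x ∂μ = 0) :
    ∀ r > 0, HasDerivAt (fun r => w |r|)
      (hinv (max (flux (Module.finrank ℝ E - 1) g r) 0)) r := by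
  obtain ⟨e, he⟩ := exists_norm_eq E zero_le_one
  set u : E → ℝ := fun x => w ‖x‖ with hudef
  set p : ℝ → ℝ := fun r => fderiv ℝ u (r • e) e with hpdef
  have hpc : Continuous p := by
    have := hu.continuous_fderiv one_ne_zero
    fun_prop
  have hW : ∀ r, HasDerivAt (fun r => w |r|) (p r) r := by
    intro r
    have h1 : HasDerivAt (fun r : ℝ => r • e) e r := by
      simpa using (hasDerivAt_id r).smul_const e
    have h2 := ((hu.differentiable one_ne_zero) (r • e)).hasFDerivAt.comp_hasDerivAt r h1
    simpa [hudef, Function.comp_def, norm_smul, he] using h2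
  have hp0 : p 0 = 0 := by
    have h1 : HasDerivAt (fun r => w |r|) (p 0) (-0) := by simpa using hW 0
    have h2 := h1.scomp (0 : ℝ) (hasDerivAt_neg 0)
    have h3 : HasDerivAt (fun r => w |r|) (-p 0) 0 := by
      simpa [Function.comp_def] using h2
    have := (hW 0).unique h3
    linarith
  have hgrad : ∀ x : E, HasGradientAt u ((p ‖x‖ / ‖x‖) • x) x := by
    intro x
    simpa [hudef] using hasGradientAt_radial (E := E) hp0 hW x
  set V : ℝ → ℝ := fun r => φ |p r| * p r with hVdef
  have hVpos : ∀ r, 0 < p r → V r = hfun (p r) := by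
    intro r hr
    rw [hVdef, hhdef _ hr]
    simp only [abs_of_pos hr]
  have hVc : Continuous V := by
    have e1 : V = fun r => hfun (max (p r) 0) - hfun (max (-p r) 0) := by
      funext r
      rcases lt_trichotomy (p r) 0 with h | h | h
      · rw [max_eq_right h.le, max_eq_left (neg_nonneg.2 h.le), hh0, hhdef _ (neg_pos.2 h)]
        simp only [hVdef, abs_of_neg h]
        ring
      · simp [hVdef, h]
      · rw [max_eq_left h.le, max_eq_right (neg_nonpos.2 h.le), hh0, sub_zero, hVpos r h]
    rw [e1]
    exact (hcont.comp hpc).sub (hcont.comp hpc.neg)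
  have hfl := flux_eq_of_weak_divergence_radial μ hVc hg fun ψ hψ hψc => by
    have := hweak ψ hψ hψc
    simp only [fun x => mul_inner_gradient_radial φ ψ (hgrad x)] at this
    exact this
  intro r hr
  have hVr : V r = flux (Module.finrank ℝ E - 1) g r := by
    have h1 := hfl r hr
    rw [← pow_mul_flux] at h1
    exact mul_left_cancel₀ (pow_pos hr _).ne' h1
  have hV0 : 0 ≤ V r := hVr ▸ flux_nonneg _ hg0 hr.le
  have hp : p r = hinv (max (flux (Module.finrank ℝ E - 1) g r) 0) := by
    rw [← hVr, max_eq_left hV0]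
    rcases lt_trichotomy (p r) 0 with h | h | h
    · have := mul_neg_of_pos_of_neg (hφpos |p r| (abs_pos.2 h.ne)) h
      exact absurd hV0 (not_le.2 this)
    · have hz : V r = 0 := by simp [hVdef, h]
      simpa [hz, h, hh0] using (hinv_left 0 le_rfl).symm
    · rw [hVpos r h, hinv_left _ h.le]
  exact hp ▸ hW r

end RadialSolutions
lemma iff_and_imp_of_imp_exists {α : Type*} {P : Prop} {A B C : α → Prop}
    (h : P → ∃ w, A w ∧ B w ∧ C w) (h' : (∃ w, A w ∧ B w) → P) :
    (P ↔ ∃ w, A w ∧ B w) ∧ (P → ∃ w, A w ∧ B w ∧ C w) :=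
  ⟨⟨fun hP => (h hP).imp fun _ hw => ⟨hw.1, hw.2.1⟩, h'⟩, h⟩

lemma nonlinearity_max {f : ℝ → ℝ} (hf_cont : ContinuousOn f (Ici 0)) (hf0 : f 0 = 0)
    (hf_pos : ∀ s > (0:ℝ), 0 < f s) (hf_mono : MonotoneOn f (Ici 0)) :
    Nonlinearity fun s => f (max s 0) where
  cont := hf_cont.comp_continuous (by fun_prop) fun _ => mem_Ici.2 (le_max_right _ _)
  mono := fun _ _ h => hf_mono (mem_Ici.2 (le_max_right _ _)) (mem_Ici.2 (le_max_right _ _))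
    (max_le_max_right 0 h)
  pos := fun s hs => by simpa [max_eq_left hs.le] using hf_pos s hs
  nonneg := fun s => by
    simpa [hf0] using hf_mono (mem_Ici.2 le_rfl) (le_max_right s 0) (le_max_right s 0)

/-- A continuous weight that is positive somewhere on the open half-line is bounded below by a
positive constant on some compact interval. -/
lemma exists_Icc_lower_bound {ρ : ℝ → ℝ} (hρ : Continuous ρ) {r : ℝ} (hr : 0 < r)
    (hρr : 0 < ρ r) :
    ∃ a b c, 0 < a ∧ a < b ∧ 0 < c ∧ ∀ t ∈ Icc a b, c ≤ ρ t := by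
  have h1 : ∀ᶠ t in nhds r, ρ r / 2 < ρ t :=
    hρ.continuousAt.eventually_const_lt (half_lt_self hρr)
  obtain ⟨ε, hε, h⟩ := Metric.eventually_nhds_iff.1 h1
  refine ⟨r, r + ε / 2, ρ r / 2, hr, by linarith, by positivity, fun t ht => (h ?_).le⟩
  rw [Real.dist_eq, abs_lt]
  constructor <;> linarith [ht.1, ht.2]

/-- Corollary to Theorems 1.2/1.3: under (φ₁)-(φ₃), for a
continuous radially symmetric a(x) = ρ(|x|) ≥ 0 satisfying (A_a) and f continuous,
non-decreasing, f(0)=0, f>0 on (0,∞): f fails the φ-Keller–Osserman condition iff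
there is a sequence of positive radial entire blow-up solutions u_k(x) = w_k(|x|)
of Δ_φ u = a(x)f(u) with u_k(0) → ∞; moreover the constructed profiles satisfy
w_k' ≥ 0 on [0,∞). -/
theorem stmt18
    (N : ℕ) (hN : 1 ≤ N)
    (φ Φ Φinv hfun hinv : ℝ → ℝ)
    (hφC1 : ContDiffOn ℝ 1 φ (Set.Ioi 0))
    (hφpos : ∀ t > (0:ℝ), 0 < φ t)
    (hΦ : ∀ t : ℝ, Φ t = ∫ s in (0:ℝ)..|t|, φ s * s)
    (hφ1 : ∀ t > (0:ℝ), 0 < deriv (fun s => φ s * s) t)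
    (l m l₁ m₁ : ℝ) (hl : 1 < l) (hm : 1 < m)
    (hφ2 : ∀ t > (0:ℝ), l ≤ φ t * t ^ 2 / Φ t ∧ φ t * t ^ 2 / Φ t ≤ m)
    (hl₁ : 0 < l₁) (hm₁ : 0 < m₁)
    (hφ3 : ∀ t > (0:ℝ), l₁ ≤ deriv (fun s => φ s * s) t * t / (φ t * t) ∧
      deriv (fun s => φ s * s) t * t / (φ t * t) ≤ m₁)
    (hΦinv_nonneg : ∀ t ≥ (0:ℝ), 0 ≤ Φinv t)
    (hΦinv_left : ∀ t ≥ (0:ℝ), Φinv (Φ t) = t)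
    (hΦinv_right : ∀ t ≥ (0:ℝ), Φ (Φinv t) = t)
    (hh0 : hfun 0 = 0)
    (hhdef : ∀ t > (0:ℝ), hfun t = φ t * t)
    (hinv_nonneg : ∀ t ≥ (0:ℝ), 0 ≤ hinv t)
    (hinv_left : ∀ t ≥ (0:ℝ), hinv (hfun t) = t)
    (hinv_right : ∀ t ≥ (0:ℝ), hfun (hinv t) = t)
    (ρ : ℝ → ℝ)
    (hρ_cont : ContinuousOn ρ (Set.Ici 0))
    (hρ_nonneg : ∀ r ≥ (0:ℝ), 0 ≤ ρ r)
    (hAρ : ¬ IntegrableOn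
      (fun s => hinv (s ^ ((1:ℝ) - N) * ∫ t in (0:ℝ)..s, t ^ (N - 1) * ρ t))
      (Set.Ioi 1))
    (f : ℝ → ℝ)
    (hf_cont : ContinuousOn f (Set.Ici 0))
    (hf0 : f 0 = 0)
    (hf_pos : ∀ s > (0:ℝ), 0 < f s)
    (hf_mono : MonotoneOn f (Set.Ici 0)) :
    -- Sol w : "u(x) = w(|x|) is a positive radial entire blow-up solution"
    (letI Sol : (ℝ → ℝ) → Prop := fun w =>
      ContDiff ℝ 1 (fun x : EuclideanSpace ℝ (Fin N) => w ‖x‖) ∧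
      (∀ x : EuclideanSpace ℝ (Fin N), 0 < w ‖x‖) ∧
      (∀ ψ : EuclideanSpace ℝ (Fin N) → ℝ, ContDiff ℝ (⊤ : ℕ∞) ψ → HasCompactSupport ψ →
        (∫ x : EuclideanSpace ℝ (Fin N),
            φ ‖gradient (fun y : EuclideanSpace ℝ (Fin N) => w ‖y‖) x‖ *
              ⟪gradient (fun y : EuclideanSpace ℝ (Fin N) => w ‖y‖) x, gradient ψ x⟫) +
          (∫ x : EuclideanSpace ℝ (Fin N), ρ ‖x‖ * f (w ‖x‖) * ψ x) = 0) ∧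
      (∀ M : ℝ, ∃ R : ℝ, ∀ x : EuclideanSpace ℝ (Fin N), R < ‖x‖ → M < w ‖x‖) ;
    ((¬ IntegrableOn (fun t => 1 / Φinv (∫ s in (0:ℝ)..t, f s)) (Set.Ioi 1)) ↔
      (∃ w : ℕ → ℝ → ℝ, (∀ k, Sol (w k)) ∧
        Filter.Tendsto (fun k => w k 0) Filter.atTop Filter.atTop)) ∧
    ((¬ IntegrableOn (fun t => 1 / Φinv (∫ s in (0:ℝ)..t, f s)) (Set.Ioi 1)) →
      ∃ w : ℕ → ℝ → ℝ, (∀ k, Sol (w k)) ∧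
        Filter.Tendsto (fun k => w k 0) Filter.atTop Filter.atTop ∧
        ∀ k, ∀ r ≥ (0:ℝ), 0 ≤ derivWithin (w k) (Set.Ici 0) r)) := by
  obtain ⟨n, rfl⟩ : ∃ n, N = n + 1 := ⟨N - 1, by omega⟩
  have H := inversePair_of_hypotheses φ Φ Φinv hfun hinv hφC1 hφpos hΦ hφ1 l m l₁ hl hm hφ2 hl₁
    (fun t ht => (hφ3 t ht).1) hΦinv_nonneg hΦinv_left hΦinv_right hh0 hhdef hinv_nonneg
    hinv_left hinv_right
  have hsm := strictMonoOn_profile hφC1 hφpos hφ1 hh0 hhdef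
  have hhc : Continuous fun v => hfun (max v 0) :=
    continuous_max_of_monotoneOn_surjOn hh0 hsm.monotoneOn
      fun y hy => ⟨hinv y, hinv_nonneg y hy, hinv_right y hy⟩
  have hinv0 : hinv 0 = 0 := by simpa [hh0] using hinv_left 0 le_rfl
  have hf := nonlinearity_max hf_cont hf0 hf_pos hf_mono
  have hρc : Continuous fun r => ρ |r| :=
    hρ_cont.comp_continuous continuous_abs fun r => abs_nonneg r
  have hρ0 : ∀ r, 0 ≤ ρ |r| := fun r => hρ_nonneg _ (abs_nonneg r)
  have hfin : Module.finrank ℝ (EuclideanSpace ℝ (Fin (n + 1))) - 1 = n := by simp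
  have hKO_iff : IntegrableOn (fun t => 1 / Φinv (∫ s in (0:ℝ)..t, f s)) (Ioi 1) ↔
      IntegrableOn (koIntegrand Φinv fun s => f (max s 0)) (Ioi 1) := by
    refine integrableOn_congr_fun (fun t ht => ?_) measurableSet_Ioi
    have ht0 : (0:ℝ) ≤ t := zero_le_one.trans (mem_Ioi.1 ht).le
    simp only [koIntegrand]
    congr 2
    refine intervalIntegral.integral_congr fun s hs => ?_
    rw [uIcc_of_le ht0] at hs
    simp only [max_eq_left hs.1]
  have hA : ¬ IntegrableOn (fun s => hinv (max (flux n (fun r => ρ |r|) s) 0)) (Ioi 1) := by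
    refine fun h => hAρ ((integrableOn_congr_fun (fun s hs => ?_) measurableSet_Ioi).1 h)
    have hs0 : (0:ℝ) < s := zero_lt_one.trans (mem_Ioi.1 hs)
    have e1 : ∫ t in (0:ℝ)..s, t ^ (n + 1 - 1) * ρ t = s ^ n * flux n (fun r => ρ |r|) s := by
      rw [pow_mul_flux]
      refine intervalIntegral.integral_congr fun t ht => ?_
      rw [uIcc_of_le hs0.le] at ht
      simp only [abs_of_nonneg ht.1, Nat.add_sub_cancel]
    have e2 : s ^ ((1:ℝ) - ((n + 1 : ℕ) : ℝ)) = (s ^ n)⁻¹ := by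
      rw [← Real.rpow_natCast, ← Real.rpow_neg hs0.le]
      congr 1
      push_cast
      ring
    simp only [e1, e2]
    rw [inv_mul_cancel_left₀ (pow_pos hs0 n).ne', max_eq_left (flux_nonneg n hρ0 hs0.le)]
  refine iff_and_imp_of_imp_exists (fun hKO => ?_) ?_
  · rw [hKO_iff] at hKO
    choose w hwc hw using fun j : ℕ =>
      exists_radial_profile H hf n hρc hρ0 hKO (α := (j:ℝ) + 1) (by simp)
    have hwd : ∀ j r, HasDerivAt (w j)
        (hinv (max (flux n (fun t => ρ |t| * f (max (w j t) 0)) r) 0)) r := by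
      intro j r
      have h1 := hasDerivAt_radialStep H hf n hρc ((j:ℝ) + 1) (hwc j) r
      rwa [show radialStep _ _ _ _ _ (w j) = w j from funext fun r => (hw j r).symm] at h1
    have hge : ∀ (j : ℕ) r, (j:ℝ) + 1 ≤ w j r := fun j r =>
      (le_radialStep H hf n hρ0 _ (w j) r).trans_eq (hw j r).symm
    have hpos : ∀ j r, 0 < w j r := fun j r => lt_of_lt_of_le (by positivity) (hge j r)
    refine ⟨w, fun j => ⟨?_, fun x => hpos j _, fun ψ hψ hψc => ?_, fun M => ?_⟩, ?_, ?_⟩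
    · exact contDiff_radial (continuous_kernel H hf n hρc (hwc j)) (by simp [flux_zero, hinv0])
        (hwd j)
    · have h1 := weak_solution_of_profile (E := EuclideanSpace ℝ (Fin (n + 1))) volume hh0 hhdef
        hinv_nonneg hinv_left hinv_right (g := fun t => ρ |t| * f (max (w j t) 0))
        (hρc.mul (hf.cont.comp (hwc j))) (fun t => mul_nonneg (hρ0 t) (hf.nonneg _)) (by rw [hfin]; exact hwd j)
        (hψ.of_le (by exact_mod_cast le_top)) hψc
      simpa only [abs_norm, max_eq_left (hpos j _).le] using h1
    · obtain ⟨R, -, hR⟩ := radial_profile_unbounded H hf n hρc hρ0 hA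
        (by positivity : (0:ℝ) < (j:ℝ) + 1) (hwc j) (hw j) M
      exact ⟨R, fun x hx => hR _ hx.le⟩
    · exact tendsto_atTop_mono (fun j => (le_add_of_nonneg_right zero_le_one).trans (hge j 0))
        tendsto_natCast_atTop_atTop
    · intro j r hr
      rw [(hwd j r).hasDerivWithinAt.derivWithin (uniqueDiffOn_Ici 0 r hr)]
      exact hinv_nonneg _ (le_max_right _ _)
  · rintro ⟨w, hw, hlim⟩ hKO
    rw [hKO_iff] at hKO
    obtain ⟨r, hr, hρr⟩ : ∃ r > 0, 0 < ρ |r| := by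
      by_contra! hcon
      refine hA (integrableOn_zero.congr_fun (fun s hs => ?_) measurableSet_Ioi)
      have hs0 : (0:ℝ) < s := zero_lt_one.trans (mem_Ioi.1 hs)
      have hz : flux n (fun r => ρ |r|) s ≤ 0 := by
        refine mul_nonpos_of_nonneg_of_nonpos hs0.le ?_
        rw [intervalIntegral.integral_of_le zero_le_one]
        refine setIntegral_nonpos measurableSet_Ioc fun τ hτ => ?_
        exact mul_nonpos_of_nonneg_of_nonpos (pow_nonneg hτ.1.le _) (hcon _ (mul_pos hs0 hτ.1))
      simp [max_eq_right hz, hinv0]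
    obtain ⟨a, b, c, ha, hab, hc, hbd⟩ := exists_Icc_lower_bound hρc hr hρr
    obtain ⟨M, hM⟩ := exists_profile_bound H hf n hKO hρc hρ0 ha hab hc hbd
    have hle : ∀ j, w j 0 ≤ M := by
      intro j
      obtain ⟨hC, hpos, hweak, -⟩ := hw j
      obtain ⟨e, he⟩ := exists_norm_eq (EuclideanSpace ℝ (Fin (n + 1))) zero_le_one
      have hWc : Continuous fun r => w j |r| := by
        have h1 : Continuous fun r : ℝ => w j ‖r • e‖ :=
          hC.continuous.comp (continuous_id.smul continuous_const)
        simpa [norm_smul, he] using h1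
      have hder := profile_of_weak_solution (E := EuclideanSpace ℝ (Fin (n + 1))) volume hφpos
        hh0 hhdef hhc hinv_left (g := fun t => ρ |t| * f (max (w j |t|) 0))
        (hρc.mul (hf.cont.comp hWc)) (fun t => mul_nonneg (hρ0 t) (hf.nonneg _)) hC fun ψ hψ hψc => by
          simpa only [abs_norm, max_eq_left (hpos _).le] using hweak ψ hψ hψc
      rw [hfin] at hder
      simpa using hM _ hWc hder
    obtain ⟨j, hj⟩ := (hlim.eventually_gt_atTop M).exists
    exact absurd (hle j) (not_le.2 hj)
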